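/- Let 𝒜 ⊂ (0,+∞)ᵖ be a polyhedral convex cone with associated norm ‖·‖_𝒜, let 𝒜′ be the closure of 𝒜 ∩ {a : |a|₁ ≤ 1} with extremal point set ℰ_{𝒜′}, and let 𝕊_𝒜 be the set of admissible subsets of {1,…,p}. Let f ∈ ℝⁿ, ξ ∼ N(0, σ²I_{n×n}), y = f + ξ, assume the diagonal elements of (1/n)𝕏ᵀ𝕏 are at most 1, and let λ ≥ (2σ/√n)( 1 + √(2 log(2|ℰ_{𝒜′}|)) ). Let β̂ be any solution of min_{β∈ℝᵖ}( ‖y − 𝕏β‖² + 2λ‖β‖_𝒜 ). Then for any δ ∈ (0,1), with probability at least 1 − δ, ‖𝕏β̂ − f‖ ≤ min over S ∈ 𝕊_𝒜 of [ min_{β: supp(β)=S} ‖𝕏β − f‖ + 3λ/(2 q_𝒜(S,3)) ] + σΦ⁻¹(1−δ)/√n; moreover E‖𝕏β̂ − f‖ ≤ min over S ∈ 𝕊_𝒜 of [ min_{β: supp(β)=S} ‖𝕏β − f‖ + 3λ/(2 q_𝒜(S,3)) ] + σ/√(2πn), with the convention a/0 = +∞ for a > 0. -/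

import Mathlib

open MeasureTheory ProbabilityTheory
open scoped ENNReal

/-- The scaled Euclidean norm `‖u‖ = sqrt((1/n) ∑ u_i²)` on `ℝⁿ`. -/
noncomputable def scaledNorm {n : ℕ} (u : Fin n → ℝ) : ℝ :=
  Real.sqrt ((∑ i, u i ^ 2) / n)

/-- The standard normal cumulative distribution function `Φ`. -/
noncomputable def stdPhi (t : ℝ) : ℝ :=
  (gaussianReal 0 1 (Set.Iic t)).toReal

/-- The Gaussian measure `N(0, σ²I_{n×n})` on `ℝⁿ` (i.i.d. `N(0,σ²)` components). -/
noncomputable def gaussianVec (n : ℕ) (σ : ℝ) : Measure (Fin n → ℝ) :=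
  Measure.pi fun _ : Fin n => gaussianReal 0 ⟨σ ^ 2, sq_nonneg σ⟩

/-- Restriction of a vector to a set of coordinates (zero off `S`). -/
def restr {p : ℕ} (S : Finset (Fin p)) (β : Fin p → ℝ) : Fin p → ℝ :=
  fun j => if j ∈ S then β j else 0

/-- The norm generated by a convex cone `𝒜 ⊂ (0,∞)ᵖ`. -/
noncomputable def coneNorm {p : ℕ} (A : Set (Fin p → ℝ)) (β : Fin p → ℝ) : ℝ :=
  sInf {r | ∃ a ∈ A, r = (1 / 2) * ∑ j, (β j ^ 2 / a j + a j)}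

/-- `S` is admissible with respect to `𝒜`. -/
def Admissible {p : ℕ} (A : Set (Fin p → ℝ)) (S : Finset (Fin p)) : Prop :=
  ∀ a ∈ A, ∀ ε > (0:ℝ), ∃ bc bs : Fin p → ℝ,
    (∀ j ∈ S, bc j = 0) ∧ (∀ j ∉ S, 0 < bc j ∧ bc j < ε) ∧
    (∀ j ∉ S, bs j = 0) ∧ (∀ j ∈ S, 0 < bs j ∧ bs j < ε) ∧
    (restr S a + bc) ∈ A ∧ (restr Sᶜ a + bs) ∈ A

/-- The squared RE-type constant `q_𝒜²(S,c₀)`. -/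
noncomputable def qASq {n p : ℕ} (X : Matrix (Fin n) (Fin p) ℝ)
    (A : Set (Fin p → ℝ)) (S : Finset (Fin p)) (c₀ : ℝ) : ℝ :=
  sInf {r | ∃ Δ : Fin p → ℝ, restr S Δ ≠ 0 ∧
    coneNorm A (restr Sᶜ Δ) ≤ c₀ * coneNorm A (restr S Δ) ∧
    r = scaledNorm (X.mulVec Δ) ^ 2 / coneNorm A (restr S Δ) ^ 2}

section

open Filter Topology

/-- The standard normal density. -/
noncomputable def stdDensity (t : ℝ) : ℝ :=
  (Real.sqrt (2 * Real.pi))⁻¹ * Real.exp (-t ^ 2 / 2)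

lemma stdDensity_eq_gaussianPDFReal (t : ℝ) : stdDensity t = gaussianPDFReal 0 1 t := by
  simp [stdDensity, gaussianPDFReal]

lemma stdDensity_pos (t : ℝ) : 0 < stdDensity t := by
  unfold stdDensity; positivity

lemma continuous_stdDensity : Continuous stdDensity := by
  unfold stdDensity; fun_prop

lemma stdDensity_neg (t : ℝ) : stdDensity (-t) = stdDensity t := by
  simp [stdDensity]

lemma hasDerivAt_stdDensity (t : ℝ) : HasDerivAt stdDensity (-t * stdDensity t) t := by
  have h1 : HasDerivAt (fun t : ℝ => -t ^ 2 / 2) (-t) t := by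
    refine (((hasDerivAt_pow 2 t).fun_neg).div_const 2).congr_deriv ?_
    simp; ring
  refine ((h1.exp).const_mul (Real.sqrt (2 * Real.pi))⁻¹).congr_deriv ?_
  unfold stdDensity; ring

lemma stdDensity_le_of_abs_le {s t : ℝ} (h : |s| ≤ |t|) : stdDensity t ≤ stdDensity s := by
  unfold stdDensity
  have := sq_le_sq.2 h
  gcongr

lemma inv_sqrt_two_pi_le_one : (Real.sqrt (2 * Real.pi))⁻¹ ≤ 1 := by
  apply inv_le_one_of_one_le₀
  rw [Real.one_le_sqrt]
  have := Real.pi_gt_three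
  linarith

lemma stdDensity_le_one (t : ℝ) : stdDensity t ≤ 1 := by
  refine (stdDensity_le_of_abs_le (s := 0) (by simp)).trans ?_
  simpa [stdDensity] using inv_sqrt_two_pi_le_one

lemma abs_mul_stdDensity_le_one (t : ℝ) : |t * stdDensity t| ≤ 1 := by
  rw [abs_mul, abs_of_pos (stdDensity_pos t)]
  unfold stdDensity
  have h1 : |t| ≤ Real.exp (t ^ 2 / 2) := by
    have := Real.add_one_le_exp (t ^ 2 / 2)
    nlinarith [sq_abs t, sq_nonneg (|t| - 1)]
  have h2 : Real.exp (-t ^ 2 / 2) = (Real.exp (t ^ 2 / 2))⁻¹ := by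
    rw [← Real.exp_neg]; congr 1; ring
  have h3 : |t| * Real.exp (-t ^ 2 / 2) ≤ 1 := by
    rw [h2]; exact mul_inv_le_one_of_le₀ h1 (Real.exp_nonneg _)
  calc |t| * ((Real.sqrt (2 * Real.pi))⁻¹ * Real.exp (-t ^ 2 / 2))
      = (Real.sqrt (2 * Real.pi))⁻¹ * (|t| * Real.exp (-t ^ 2 / 2)) := by ring
    _ ≤ 1 * 1 := by gcongr; exact inv_sqrt_two_pi_le_one
    _ = 1 := one_mul 1

lemma integrable_stdDensity : Integrable stdDensity := by
  simpa [funext stdDensity_eq_gaussianPDFReal] using integrable_gaussianPDFReal 0 1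

lemma stdPhi_eq_integral (t : ℝ) : stdPhi t = ∫ x in Set.Iic t, stdDensity x := by
  unfold stdPhi
  rw [gaussianReal_apply_eq_integral _ one_ne_zero, ENNReal.toReal_ofReal]
  · simp [stdDensity_eq_gaussianPDFReal]
  · exact integral_nonneg fun x => gaussianPDFReal_nonneg _ _ _

lemma hasDerivAt_stdPhi (t : ℝ) : HasDerivAt stdPhi (stdDensity t) t := by
  have h : ∀ u, stdPhi u = stdPhi 0 + ∫ x in (0 : ℝ)..u, stdDensity x := by
    intro u
    rw [stdPhi_eq_integral, stdPhi_eq_integral,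
      ← intervalIntegral.integral_Iic_sub_Iic integrable_stdDensity.integrableOn
        integrable_stdDensity.integrableOn]
    ring
  rw [funext h]
  exact (intervalIntegral.integral_hasDerivAt_right
    (continuous_stdDensity.intervalIntegrable _ _)
    (continuous_stdDensity.stronglyMeasurableAtFilter _ _)
    continuous_stdDensity.continuousAt).const_add _

lemma continuous_stdPhi : Continuous stdPhi :=
  continuous_iff_continuousAt.2 fun t => (hasDerivAt_stdPhi t).continuousAt

lemma strictMono_stdPhi : StrictMono stdPhi :=
  strictMono_of_hasDerivAt_pos hasDerivAt_stdPhi stdDensity_pos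

lemma stdPhi_eq_cdf : stdPhi = cdf (gaussianReal 0 1) := by
  ext t; rw [cdf_eq_real]; rfl

lemma tendsto_stdPhi_atBot : Tendsto stdPhi atBot (𝓝 0) := by
  rw [stdPhi_eq_cdf]; exact tendsto_cdf_atBot _

lemma tendsto_stdPhi_atTop : Tendsto stdPhi atTop (𝓝 1) := by
  rw [stdPhi_eq_cdf]; exact tendsto_cdf_atTop _

lemma stdPhi_pos (t : ℝ) : 0 < stdPhi t :=
  (strictMono_stdPhi.monotone.le_of_tendsto tendsto_stdPhi_atBot (t - 1)).trans_lt
    (strictMono_stdPhi (by linarith))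

lemma stdPhi_lt_one (t : ℝ) : stdPhi t < 1 :=
  (strictMono_stdPhi (by linarith)).trans_le
    (strictMono_stdPhi.monotone.ge_of_tendsto tendsto_stdPhi_atTop (t + 1))

lemma stdPhi_add_stdPhi_neg (t : ℝ) : stdPhi t + stdPhi (-t) = 1 := by
  have h : ∀ x, HasDerivAt (fun t => stdPhi t + stdPhi (-t)) 0 x := by
    intro x
    have h2 : HasDerivAt (fun t => stdPhi (-t)) (stdDensity (-x) * -1) x :=
      (hasDerivAt_stdPhi (-x)).comp x (hasDerivAt_neg x)
    refine ((hasDerivAt_stdPhi x).fun_add h2).congr_deriv ?_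
    rw [stdDensity_neg]; ring
  have hc : ∀ x, stdPhi x + stdPhi (-x) = stdPhi t + stdPhi (-t) := fun x =>
    is_const_of_deriv_eq_zero (fun y => (h y).differentiableAt) (fun y => (h y).deriv) x t
  have hl : Tendsto (fun t => stdPhi t + stdPhi (-t)) atTop (𝓝 (1 + 0)) :=
    tendsto_stdPhi_atTop.add (tendsto_stdPhi_atBot.comp tendsto_neg_atTop_atBot)
  simp only [hc, add_zero] at hl
  exact tendsto_nhds_unique tendsto_const_nhds hl

lemma stdPhi_zero : stdPhi 0 = 1 / 2 := by
  have := stdPhi_add_stdPhi_neg 0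
  rw [neg_zero] at this; linarith

lemma exists_stdPhi_eq {x : ℝ} (hx : x ∈ Set.Ioo (0 : ℝ) 1) : ∃ t, stdPhi t = x :=
  mem_range_of_exists_le_of_exists_ge continuous_stdPhi
    ((tendsto_stdPhi_atBot.eventually_le_const hx.1).exists)
    ((tendsto_stdPhi_atTop.eventually_const_le hx.2).exists)

/-- The standard normal quantile function. -/
noncomputable def stdQuantile : ℝ → ℝ := Function.invFun stdPhi

lemma stdQuantile_stdPhi (t : ℝ) : stdQuantile (stdPhi t) = t :=
  Function.leftInverse_invFun strictMono_stdPhi.injective t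

lemma stdPhi_stdQuantile {x : ℝ} (hx : x ∈ Set.Ioo (0 : ℝ) 1) : stdPhi (stdQuantile x) = x :=
  Function.invFun_eq (exists_stdPhi_eq hx)

lemma stdQuantile_strictMonoOn : StrictMonoOn stdQuantile (Set.Ioo 0 1) := by
  intro x hx y hy hxy
  rwa [← strictMono_stdPhi.lt_iff_lt, stdPhi_stdQuantile hx, stdPhi_stdQuantile hy]

lemma stdQuantile_one_sub {x : ℝ} (hx : x ∈ Set.Ioo (0 : ℝ) 1) :
    stdQuantile (1 - x) = -stdQuantile x := by
  have := stdPhi_add_stdPhi_neg (stdQuantile x)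
  rw [stdPhi_stdQuantile hx] at this
  rw [← stdQuantile_stdPhi (-stdQuantile x)]
  congr 1; linarith

lemma continuousAt_stdQuantile {x : ℝ} (hx : x ∈ Set.Ioo (0 : ℝ) 1) :
    ContinuousAt stdQuantile x := by
  refine stdQuantile_strictMonoOn.continuousAt_of_image_mem_nhds (Ioo_mem_nhds hx.1 hx.2) ?_
  have : stdQuantile '' Set.Ioo 0 1 = Set.univ := by
    ext t
    simp only [Set.mem_univ, iff_true]
    exact ⟨stdPhi t, ⟨stdPhi_pos t, stdPhi_lt_one t⟩, stdQuantile_stdPhi t⟩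
  rw [this]; exact univ_mem

lemma hasDerivAt_stdQuantile {x : ℝ} (hx : x ∈ Set.Ioo (0 : ℝ) 1) :
    HasDerivAt stdQuantile (stdDensity (stdQuantile x))⁻¹ x := by
  refine HasDerivAt.of_local_left_inverse (continuousAt_stdQuantile hx) (hasDerivAt_stdPhi _)
    (stdDensity_pos _).ne' ?_
  filter_upwards [Ioo_mem_nhds hx.1 hx.2] with y hy using stdPhi_stdQuantile hy

/-- The Gaussian isoperimetric profile. -/
noncomputable def gaussProfile (x : ℝ) : ℝ := stdDensity (stdQuantile x)

lemma gaussProfile_pos (x : ℝ) : 0 < gaussProfile x := stdDensity_pos _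

lemma gaussProfile_stdPhi (t : ℝ) : gaussProfile (stdPhi t) = stdDensity t := by
  rw [gaussProfile, stdQuantile_stdPhi]

lemma gaussProfile_one_sub {x : ℝ} (hx : x ∈ Set.Ioo (0 : ℝ) 1) :
    gaussProfile (1 - x) = gaussProfile x := by
  rw [gaussProfile, stdQuantile_one_sub hx, stdDensity_neg, gaussProfile]

lemma hasDerivAt_gaussProfile {x : ℝ} (hx : x ∈ Set.Ioo (0 : ℝ) 1) :
    HasDerivAt gaussProfile (-stdQuantile x) x := by
  refine ((hasDerivAt_stdDensity (stdQuantile x)).comp x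
    (hasDerivAt_stdQuantile hx)).congr_deriv ?_
  have := (stdDensity_pos (stdQuantile x)).ne'
  field_simp

/-- The squared quantile function is midpoint convex. -/
lemma two_mul_sq_stdQuantile_le {c x : ℝ} (h1 : c - x ∈ Set.Ioo (0 : ℝ) 1)
    (h2 : c + x ∈ Set.Ioo (0 : ℝ) 1) :
    2 * stdQuantile c ^ 2 ≤ stdQuantile (c + x) ^ 2 + stdQuantile (c - x) ^ 2 := by
  have hd : ∀ y ∈ Set.Ioo (0 : ℝ) 1, HasDerivAt (fun y => stdQuantile y ^ 2)
      (2 * stdQuantile y * (gaussProfile y)⁻¹) y := by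
    intro y hy
    refine ((hasDerivAt_stdQuantile hy).fun_pow 2).congr_deriv ?_
    simp [gaussProfile]
  have hm : Monotone fun t : ℝ => 2 * t * (stdDensity t)⁻¹ := by
    have hd' : ∀ t, HasDerivAt (fun t : ℝ => 2 * t * (stdDensity t)⁻¹)
        (2 * (stdDensity t)⁻¹ * (1 + t ^ 2)) t := by
      intro t
      have hp := (stdDensity_pos t).ne'
      refine (((hasDerivAt_id t).const_mul 2).fun_mul
        ((hasDerivAt_stdDensity t).fun_inv hp)).congr_deriv ?_
      simp only [id]
      field_simp
    refine monotone_of_hasDerivAt_nonneg hd' fun t => ?_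
    have := stdDensity_pos t
    positivity
  have hconv : ConvexOn ℝ (Set.Ioo (0 : ℝ) 1) fun y => stdQuantile y ^ 2 := by
    refine MonotoneOn.convexOn_of_deriv (convex_Ioo 0 1)
      (fun y hy => (hd y hy).continuousAt.continuousWithinAt) ?_ ?_
    · rw [interior_Ioo]
      exact fun y hy => (hd y hy).differentiableAt.differentiableWithinAt
    · rw [interior_Ioo]
      intro y hy z hz hyz
      rw [(hd y hy).deriv, (hd z hz).deriv]
      exact hm (stdQuantile_strictMonoOn.monotoneOn hy hz hyz)
  have := hconv.2 h2 h1 (by norm_num : (0 : ℝ) ≤ 1 / 2) (by norm_num : (0 : ℝ) ≤ 1 / 2)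
    (by norm_num)
  simp only [smul_eq_mul] at this
  have e : 1 / 2 * (c + x) + 1 / 2 * (c - x) = c := by ring
  rw [e] at this
  linarith

end

section

open Filter Topology

lemma hasDerivAt_sq_gaussProfile {x : ℝ} (hx : x ∈ Set.Ioo (0 : ℝ) 1) :
    HasDerivAt (fun y => gaussProfile y ^ 2) (-2 * (gaussProfile x * stdQuantile x)) x := by
  refine ((hasDerivAt_gaussProfile hx).fun_pow 2).congr_deriv ?_
  simp; ring

lemma hasDerivAt_gaussProfile_mul_stdQuantile {x : ℝ} (hx : x ∈ Set.Ioo (0 : ℝ) 1) :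
    HasDerivAt (fun y => gaussProfile y * stdQuantile y) (1 - stdQuantile x ^ 2) x := by
  refine ((hasDerivAt_gaussProfile hx).fun_mul (hasDerivAt_stdQuantile hx)).congr_deriv ?_
  have := (gaussProfile_pos x).ne'
  rw [gaussProfile] at this ⊢
  field_simp
  ring

/-- A function with value and first derivative zero at `0` and nonnegative second derivative is
nonnegative on `[0, r]`. -/
lemma nonneg_of_second_deriv_nonneg {r : ℝ} {f f' f'' : ℝ → ℝ} (h0 : f 0 = 0) (h0' : f' 0 = 0)
    (hf : ∀ x ∈ Set.Icc 0 r, HasDerivAt f (f' x) x)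
    (hf' : ∀ x ∈ Set.Icc 0 r, HasDerivAt f' (f'' x) x)
    (hf'' : ∀ x ∈ Set.Icc 0 r, 0 ≤ f'' x) {x : ℝ} (hx : x ∈ Set.Icc 0 r) : 0 ≤ f x := by
  have h0r : (0 : ℝ) ∈ Set.Icc 0 r := ⟨le_rfl, hx.1.trans hx.2⟩
  have m1 : MonotoneOn f' (Set.Icc 0 r) := by
    refine monotoneOn_of_deriv_nonneg (convex_Icc 0 r)
      (fun y hy => (hf' y hy).continuousAt.continuousWithinAt)
      (fun y hy => (hf' y (interior_subset hy)).differentiableAt.differentiableWithinAt)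
      fun y hy => ?_
    rw [(hf' y (interior_subset hy)).deriv]
    exact hf'' y (interior_subset hy)
  have m0 : MonotoneOn f (Set.Icc 0 r) := by
    refine monotoneOn_of_deriv_nonneg (convex_Icc 0 r)
      (fun y hy => (hf y hy).continuousAt.continuousWithinAt)
      (fun y hy => (hf y (interior_subset hy)).differentiableAt.differentiableWithinAt)
      fun y hy => ?_
    rw [(hf y (interior_subset hy)).deriv]
    have := m1 h0r (interior_subset hy) (interior_subset hy).1
    rwa [h0'] at this
  have := m0 h0r hx hx.1
  rwa [h0] at this

lemma add_mem_Ioo_of_mem_Icc {c x y : ℝ} (h1 : c - x ∈ Set.Ioo (0 : ℝ) 1)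
    (h2 : c + x ∈ Set.Ioo (0 : ℝ) 1) (hy : y ∈ Set.Icc 0 x) :
    c - y ∈ Set.Ioo (0 : ℝ) 1 ∧ c + y ∈ Set.Ioo (0 : ℝ) 1 := by
  simp only [Set.mem_Ioo, Set.mem_Icc] at *
  refine ⟨⟨?_, ?_⟩, ?_, ?_⟩ <;> linarith

lemma sq_gaussProfile_second_difference {c x : ℝ} (hx : 0 ≤ x) (h1 : c - x ∈ Set.Ioo (0 : ℝ) 1)
    (h2 : c + x ∈ Set.Ioo (0 : ℝ) 1) :
    2 * stdQuantile c ^ 2 * x ^ 2 + 2 * gaussProfile c ^ 2 ≤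
      gaussProfile (c + x) ^ 2 + gaussProfile (c - x) ^ 2 + 2 * x ^ 2 := by
  have hI := fun y hy => add_mem_Ioo_of_mem_Icc (c := c) (x := x) (y := y) h1 h2 hy
  have hp : ∀ y : ℝ, HasDerivAt (fun y => c + y) 1 y := fun y => (hasDerivAt_id y).const_add c
  have hm : ∀ y : ℝ, HasDerivAt (fun y => c - y) (-1) y := fun y => (hasDerivAt_id y).const_sub c
  have key := nonneg_of_second_deriv_nonneg (r := x) (x := x)
    (f := fun y => gaussProfile (c + y) ^ 2 + gaussProfile (c - y) ^ 2 + 2 * y ^ 2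
      - 2 * stdQuantile c ^ 2 * y ^ 2 - 2 * gaussProfile c ^ 2)
    (f' := fun y => -2 * (gaussProfile (c + y) * stdQuantile (c + y))
      + 2 * (gaussProfile (c - y) * stdQuantile (c - y)) + 4 * y
      - 4 * stdQuantile c ^ 2 * y)
    (f'' := fun y => 2 * (stdQuantile (c + y) ^ 2 + stdQuantile (c - y) ^ 2
      - 2 * stdQuantile c ^ 2))
    (by simp; ring) (by simp)
    (fun y hy => by
      have d1 := (hasDerivAt_sq_gaussProfile (hI y hy).2).comp y (hp y)
      have d2 := (hasDerivAt_sq_gaussProfile (hI y hy).1).comp y (hm y)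
      refine ((((d1.fun_add d2).fun_add ((hasDerivAt_pow 2 y).const_mul 2)).fun_sub
        ((hasDerivAt_pow 2 y).const_mul (2 * stdQuantile c ^ 2))).sub_const
          (2 * gaussProfile c ^ 2)).congr_deriv ?_
      simp; ring)
    (fun y hy => by
      have d1 := (hasDerivAt_gaussProfile_mul_stdQuantile (hI y hy).2).comp y (hp y)
      have d2 := (hasDerivAt_gaussProfile_mul_stdQuantile (hI y hy).1).comp y (hm y)
      refine ((((d1.const_mul (-2)).fun_add (d2.const_mul 2)).fun_add
        ((hasDerivAt_id y).const_mul 4)).fun_sub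
          ((hasDerivAt_id y).const_mul (4 * stdQuantile c ^ 2))).congr_deriv ?_
      ring)
    (fun y hy => by
      have := two_mul_sq_stdQuantile_le (hI y hy).1 (hI y hy).2
      linarith)
    ⟨hx, le_rfl⟩
  linarith

lemma abs_stdQuantile_add_le_sub {c x : ℝ} (hx : 0 ≤ x) (hc : c ≤ 1 / 2)
    (h1 : c - x ∈ Set.Ioo (0 : ℝ) 1) (h2 : c + x ∈ Set.Ioo (0 : ℝ) 1) :
    |stdQuantile (c + x)| ≤ |stdQuantile (c - x)| := by
  have h3 : 1 - (c - x) ∈ Set.Ioo (0 : ℝ) 1 := ⟨by linarith [h1.2], by linarith [h1.1]⟩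
  have e1 := stdQuantile_strictMonoOn.monotoneOn h2 h3 (by linarith)
  have e2 := stdQuantile_strictMonoOn.monotoneOn h1 h2 (by linarith)
  rw [stdQuantile_one_sub h1] at e1
  rw [← abs_neg (stdQuantile (c - x))]
  exact abs_le_abs e1 (by linarith)

lemma sq_gaussProfile_first_difference {c x : ℝ} (hx : 0 ≤ x) (hc : c ≤ 1 / 2)
    (h1 : c - x ∈ Set.Ioo (0 : ℝ) 1) (h2 : c + x ∈ Set.Ioo (0 : ℝ) 1) :
    (gaussProfile (c + x) ^ 2 - gaussProfile (c - x) ^ 2) ^ 2 ≤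
      16 * gaussProfile c ^ 2 * stdQuantile c ^ 2 * x ^ 2 := by
  have hI := fun y hy => add_mem_Ioo_of_mem_Icc (c := c) (x := x) (y := y) h1 h2 hy
  have hp : ∀ y : ℝ, HasDerivAt (fun y => c + y) 1 y := fun y => (hasDerivAt_id y).const_add c
  have hm : ∀ y : ℝ, HasDerivAt (fun y => c - y) (-1) y := fun y => (hasDerivAt_id y).const_sub c
  have key := nonneg_of_second_deriv_nonneg (r := x) (x := x)
    (f := fun y => -4 * gaussProfile c * stdQuantile c * y
      - (gaussProfile (c + y) ^ 2 - gaussProfile (c - y) ^ 2))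
    (f' := fun y => -4 * gaussProfile c * stdQuantile c
      + 2 * (gaussProfile (c + y) * stdQuantile (c + y))
      + 2 * (gaussProfile (c - y) * stdQuantile (c - y)))
    (f'' := fun y => 2 * (stdQuantile (c - y) ^ 2 - stdQuantile (c + y) ^ 2))
    (by simp) (by simp; ring)
    (fun y hy => by
      have d1 := (hasDerivAt_sq_gaussProfile (hI y hy).2).comp y (hp y)
      have d2 := (hasDerivAt_sq_gaussProfile (hI y hy).1).comp y (hm y)
      refine (((hasDerivAt_id y).const_mul (-4 * gaussProfile c * stdQuantile c)).fun_sub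
        (d1.fun_sub d2)).congr_deriv ?_
      ring)
    (fun y hy => by
      have d1 := (hasDerivAt_gaussProfile_mul_stdQuantile (hI y hy).2).comp y (hp y)
      have d2 := (hasDerivAt_gaussProfile_mul_stdQuantile (hI y hy).1).comp y (hm y)
      refine (((d1.const_mul 2).const_add (-4 * gaussProfile c * stdQuantile c)).fun_add
        (d2.const_mul 2)).congr_deriv ?_
      ring)
    (fun y hy => by
      have := sq_le_sq.2 (abs_stdQuantile_add_le_sub hy.1 hc (hI y hy).1 (hI y hy).2)
      linarith)
    ⟨hx, le_rfl⟩
  have hmono : gaussProfile (c - x) ≤ gaussProfile (c + x) :=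
    stdDensity_le_of_abs_le (abs_stdQuantile_add_le_sub hx hc h1 h2)
  have hpos : 0 ≤ gaussProfile (c + x) ^ 2 - gaussProfile (c - x) ^ 2 := by
    have := gaussProfile_pos (c - x)
    nlinarith
  calc _ ≤ (-4 * gaussProfile c * stdQuantile c * x) ^ 2 :=
        pow_le_pow_left₀ hpos (by linarith) 2
    _ = _ := by ring

/-- **Bobkov's two-point inequality** for the Gaussian isoperimetric profile. -/
lemma gaussProfile_two_point {a b : ℝ} (ha : a ∈ Set.Ioo (0 : ℝ) 1) (hb : b ∈ Set.Ioo (0 : ℝ) 1) :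
    gaussProfile ((a + b) / 2) ≤ (Real.sqrt (gaussProfile a ^ 2 + ((a - b) / 2) ^ 2)
      + Real.sqrt (gaussProfile b ^ 2 + ((a - b) / 2) ^ 2)) / 2 := by
  wlog hab : b ≤ a generalizing a b
  · have := this hb ha (le_of_not_ge hab)
    rw [add_comm b a, show ((b - a) / 2) ^ 2 = ((a - b) / 2) ^ 2 by ring, add_comm (√_)] at this
    exact this
  wlog hc : (a + b) / 2 ≤ 1 / 2 generalizing a b
  · have ha' : 1 - a ∈ Set.Ioo (0 : ℝ) 1 := ⟨by linarith [ha.2], by linarith [ha.1]⟩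
    have hb' : 1 - b ∈ Set.Ioo (0 : ℝ) 1 := ⟨by linarith [hb.2], by linarith [hb.1]⟩
    have hab' : (a + b) / 2 ∈ Set.Ioo (0 : ℝ) 1 :=
      ⟨by linarith [ha.1, hb.1], by linarith [ha.2, hb.2]⟩
    have := this hb' ha' (by linarith) (by linarith)
    rw [gaussProfile_one_sub ha, gaussProfile_one_sub hb,
      show (1 - b + (1 - a)) / 2 = 1 - (a + b) / 2 by ring, gaussProfile_one_sub hab',
      show ((1 - b - (1 - a)) / 2) ^ 2 = ((a - b) / 2) ^ 2 by ring, add_comm (√_)] at this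
    exact this
  set c := (a + b) / 2 with hcdef
  set x := (a - b) / 2 with hxdef
  have hac : a = c + x := by rw [hcdef, hxdef]; ring
  have hbc : b = c - x := by rw [hcdef, hxdef]; ring
  have hx : 0 ≤ x := by rw [hxdef]; linarith
  have k1 := sq_gaussProfile_second_difference hx (hbc ▸ hb) (hac ▸ ha)
  have k2 := sq_gaussProfile_first_difference hx hc (hbc ▸ hb) (hac ▸ ha)
  rw [← hac, ← hbc] at k1 k2
  set u := gaussProfile c
  have hu : 0 < u := gaussProfile_pos c
  set P := gaussProfile a ^ 2 + x ^ 2 with hP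
  set Q := gaussProfile b ^ 2 + x ^ 2 with hQ
  have hP0 : 0 ≤ P := by positivity
  have hQ0 : 0 ≤ Q := by positivity
  have hPQ : (P - Q) ^ 2 ≤ 8 * u ^ 2 * (P + Q - 2 * u ^ 2) := by
    have : P - Q = gaussProfile a ^ 2 - gaussProfile b ^ 2 := by rw [hP, hQ]; ring
    rw [this]
    nlinarith [sq_nonneg u]
  have hs : 4 * u ^ 2 - (P + Q) ≤ 2 * (√P * √Q) := by
    rw [← Real.sqrt_mul hP0]
    by_contra! hlt
    have h0 := Real.sqrt_nonneg (P * Q)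
    have h1 := Real.sq_sqrt (mul_nonneg hP0 hQ0)
    nlinarith
  have hsum : 2 * u ≤ √P + √Q := by
    apply abs_le_of_sq_le_sq' _ (by positivity) |>.2
    nlinarith [Real.sq_sqrt hP0, Real.sq_sqrt hQ0]
  linarith

end

section

open Filter Topology BigOperators

open Finset in
lemma sqrt_sq_expect_add_sq_expect_le {α : Type*} [Fintype α] (a d : α → ℝ) :
    √((𝔼 x, a x) ^ 2 + (𝔼 x, d x) ^ 2) ≤ 𝔼 x, √(a x ^ 2 + d x ^ 2) := by
  have key : √((∑ x, a x) ^ 2 + (∑ x, d x) ^ 2) ≤ ∑ x, √(a x ^ 2 + d x ^ 2) := by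
    have := norm_sum_le univ fun x => (⟨a x, d x⟩ : ℂ)
    simpa only [Complex.norm_eq_sqrt_sq_add_sq, Complex.re_sum, Complex.im_sum] using this
  simp only [Fintype.expect_eq_sum_div_card, div_pow, ← add_div]
  rw [Real.sqrt_div (by positivity), Real.sqrt_sq (by positivity)]
  gcongr

open Finset in
lemma expect_fin_succ_bool {N : ℕ} (f : (Fin (N + 1) → Bool) → ℝ) :
    𝔼 x, f x = ((𝔼 y, f (Fin.cons true y)) + 𝔼 y, f (Fin.cons false y)) / 2 := by
  have h : 𝔼 x, f x = 𝔼 z : Bool × (Fin N → Bool), f (Fin.cons z.1 z.2) :=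
    (Fintype.expect_equiv (Fin.consEquiv fun _ => Bool) (fun z => f (Fin.cons z.1 z.2)) f
      fun _ => rfl).symm
  rw [h, ← univ_product_univ, expect_product' univ univ fun b y => f (Fin.cons b y)]
  simp only [Fintype.expect_eq_sum_div_card, Fintype.sum_bool, Fintype.card_bool]
  norm_num

open Finset in
lemma expect_mem_Ioo {α : Type*} [Fintype α] [Nonempty α] {f : α → ℝ}
    (hf : ∀ x, f x ∈ Set.Ioo (0 : ℝ) 1) : 𝔼 x, f x ∈ Set.Ioo (0 : ℝ) 1 :=
  ⟨expect_pos (fun x _ => (hf x).1) univ_nonempty,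
    expect_lt (fun x _ => (hf x).2.le) ⟨Classical.arbitrary α, mem_univ _, (hf _).2⟩⟩

open Finset in
/-- **Bobkov's inequality** on the cube indexed by `Fin N`. -/
lemma gaussProfile_cube_fin {N : ℕ} (f : (Fin N → Bool) → ℝ)
    (hf : ∀ x, f x ∈ Set.Ioo (0 : ℝ) 1) :
    gaussProfile (𝔼 x, f x) ≤ 𝔼 x, √(gaussProfile (f x) ^ 2 + ∑ i,
      ((f (Function.update x i true) - f (Function.update x i false)) / 2) ^ 2) := by
  induction N with
  | zero =>
    simp [Real.sqrt_sq (gaussProfile_pos _).le]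
  | succ N ih =>
    have h1 := ih (fun y => f (Fin.cons true y)) fun y => hf _
    have h2 := ih (fun y => f (Fin.cons false y)) fun y => hf _
    have m1 := expect_mem_Ioo (f := fun y : Fin N → Bool => f (Fin.cons true y)) fun y => hf _
    have m2 := expect_mem_Ioo (f := fun y : Fin N → Bool => f (Fin.cons false y)) fun y => hf _
    have step : ∀ (b : Bool) (A : ℝ), 0 < A →
        A ≤ (𝔼 y, √(gaussProfile (f (Fin.cons b y)) ^ 2 + ∑ i, ((f (Fin.cons b
          (Function.update y i true)) - f (Fin.cons b (Function.update y i false))) / 2) ^ 2)) →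
        √(A ^ 2 + (((𝔼 y, f (Fin.cons true y)) - 𝔼 y, f (Fin.cons false y)) / 2) ^ 2) ≤
        𝔼 y, √(gaussProfile (f (Fin.cons b y)) ^ 2 + ∑ i, ((f (Function.update
          (Fin.cons b y : Fin (N + 1) → Bool) i true) - f (Function.update
          (Fin.cons b y : Fin (N + 1) → Bool) i false)) / 2) ^ 2) := by
      intro b A hA hAle
      rw [← expect_sub_distrib, expect_div]
      refine (Real.sqrt_le_sqrt (add_le_add_left (pow_le_pow_left₀ hA.le hAle 2) _)).trans ?_
      refine (sqrt_sq_expect_add_sq_expect_le _ _).trans (expect_le_expect fun y _ => ?_)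
      refine Real.sqrt_le_sqrt ?_
      rw [Real.sq_sqrt (by positivity), Fin.sum_univ_succ]
      simp only [Fin.update_cons_zero, ← Fin.cons_update]
      linarith
    rw [expect_fin_succ_bool, expect_fin_succ_bool]
    refine (gaussProfile_two_point m1 m2).trans ?_
    have s1 := step true _ (gaussProfile_pos _) h1
    have s2 := step false _ (gaussProfile_pos _) h2
    linarith

open Finset in
/-- **Bobkov's inequality** on the discrete cube. -/
lemma gaussProfile_cube {ι : Type*} [Fintype ι] [DecidableEq ι] (f : (ι → Bool) → ℝ)
    (hf : ∀ x, f x ∈ Set.Ioo (0 : ℝ) 1) :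
    gaussProfile (𝔼 x, f x) ≤ 𝔼 x, √(gaussProfile (f x) ^ 2 + ∑ i,
      ((f (Function.update x i true) - f (Function.update x i false)) / 2) ^ 2) := by
  let e := Fintype.equivFin ι
  let E : (Fin (Fintype.card ι) → Bool) ≃ (ι → Bool) := e.symm.arrowCongr (Equiv.refl Bool)
  have h := gaussProfile_cube_fin (fun x => f (E x)) fun x => hf _
  rw [Fintype.expect_equiv E (fun x => f (E x)) f fun _ => rfl] at h
  refine h.trans_eq (Fintype.expect_equiv E _ _ fun x => ?_)
  congr 2
  refine Fintype.sum_equiv e.symm _ _ fun i => ?_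
  have hu : ∀ b, E (Function.update x i b) = Function.update (E x) (e.symm i) b := by
    intro b
    ext j
    by_cases hj : j = e.symm i
    · subst hj; simp [E]
    · have : e j ≠ i := fun h => hj (by rw [← h]; simp)
      simp [E, Function.update_of_ne hj, Function.update_of_ne this]
  rw [hu, hu]

end

section

open Filter Topology BigOperators

/-- The sign `±1` of a bit. -/
def boolSign (b : Bool) : ℝ := if b then 1 else -1

/-- The normalized sums of `n` rows of `k` signs each. -/
noncomputable def cubeSum (n k : ℕ) (x : Fin n × Fin k → Bool) : EuclideanSpace ℝ (Fin n) :=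
  WithLp.toLp 2 fun j => (√k)⁻¹ * ∑ i, boolSign (x (j, i))

/-- The law of the normalized sums under uniform signs. -/
noncomputable def cubeLaw (n k : ℕ) : Measure (EuclideanSpace ℝ (Fin n)) :=
  (PMF.uniformOfFintype (Fin n × Fin k → Bool)).toMeasure.map (cubeSum n k)

instance (n k : ℕ) : IsProbabilityMeasure (cubeLaw n k) :=
  Measure.isProbabilityMeasure_map (measurable_of_finite _).aemeasurable

lemma integral_cubeLaw {n k : ℕ} {F : Type*} [NormedAddCommGroup F] [NormedSpace ℝ F]
    [CompleteSpace F] {g : EuclideanSpace ℝ (Fin n) → F} (hg : Continuous g) :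
    ∫ z, g z ∂(cubeLaw n k) =
      ((Fintype.card (Fin n × Fin k → Bool) : ℝ)⁻¹) • ∑ x, g (cubeSum n k x) := by
  rw [cubeLaw, integral_map (measurable_of_finite _).aemeasurable hg.aestronglyMeasurable,
    PMF.integral_eq_sum, Finset.smul_sum]
  refine Finset.sum_congr rfl fun x _ => ?_
  rw [PMF.uniformOfFintype_apply]
  simp

lemma integral_cubeLaw_eq_expect {n k : ℕ} {g : EuclideanSpace ℝ (Fin n) → ℝ}
    (hg : Continuous g) : ∫ z, g z ∂(cubeLaw n k) = 𝔼 x, g (cubeSum n k x) := by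
  rw [integral_cubeLaw hg, Fintype.expect_eq_sum_div_card, smul_eq_mul, div_eq_inv_mul]

lemma sum_exp_boolSign {ι : Type*} [Fintype ι] [DecidableEq ι] (u : ι → ℝ) :
    ∑ x : ι → Bool, Complex.exp ((∑ i, u i * boolSign (x i) : ℝ) * Complex.I) =
      (Fintype.card (ι → Bool) : ℂ) * ∏ i, (Real.cos (u i) : ℂ) := by
  have h1 : ∀ x : ι → Bool, Complex.exp ((∑ i, u i * boolSign (x i) : ℝ) * Complex.I) =
      ∏ i, Complex.exp ((u i * boolSign (x i) : ℝ) * Complex.I) := by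
    intro x
    rw [← Complex.exp_sum, Complex.ofReal_sum, Finset.sum_mul]
  have h2 : ∀ i, ∑ b : Bool, Complex.exp ((u i * boolSign b : ℝ) * Complex.I) =
      2 * (Real.cos (u i) : ℂ) := by
    intro i
    rw [Fintype.sum_bool, Complex.ofReal_cos, Complex.two_cos]
    simp [boolSign]
  simp_rw [h1]
  have h3 := Finset.prod_univ_sum (fun _ : ι => (Finset.univ : Finset Bool))
    fun i b => Complex.exp ((u i * boolSign b : ℝ) * Complex.I)
  rw [Fintype.piFinset_univ] at h3
  rw [← h3]
  simp_rw [h2]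
  rw [Finset.prod_mul_distrib]
  simp

lemma charFun_cubeLaw (n k : ℕ) (t : EuclideanSpace ℝ (Fin n)) :
    charFun (cubeLaw n k) t = ((∏ j, Real.cos ((√k)⁻¹ * t j) ^ k : ℝ) : ℂ) := by
  rw [charFun_apply, integral_cubeLaw (by fun_prop)]
  have h : ∀ x : Fin n × Fin k → Bool, (inner ℝ (cubeSum n k x) t : ℝ) =
      ∑ P : Fin n × Fin k, ((√k)⁻¹ * t P.1) * boolSign (x P) := by
    intro x
    rw [Fintype.sum_prod_type, PiLp.inner_apply]
    refine Finset.sum_congr rfl fun j _ => ?_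
    simp only [cubeSum, RCLike.inner_apply, conj_trivial]
    rw [Finset.mul_sum, Finset.mul_sum]
    refine Finset.sum_congr rfl fun i _ => ?_
    ring
  simp_rw [h]
  rw [sum_exp_boolSign, Fintype.prod_prod_type, Complex.real_smul]
  push_cast
  rw [inv_mul_cancel_left₀ (by simp)]
  simp

lemma tendsto_cos_pow (t : ℝ) :
    Tendsto (fun k : ℕ => Real.cos ((√k)⁻¹ * t) ^ k) atTop (𝓝 (Real.exp (-t ^ 2 / 2))) := by
  have h : Tendsto (fun k : ℕ => (k : ℝ) * (Real.cos ((√k)⁻¹ * t) - 1)) atTop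
      (𝓝 (-t ^ 2 / 2)) := by
    have hs : Tendsto (fun k : ℕ => (√k)⁻¹ * t / 2) atTop (𝓝 0) := by
      have : Tendsto (fun k : ℕ => (√k)⁻¹) atTop (𝓝 0) :=
        tendsto_inv_atTop_zero.comp (Real.tendsto_sqrt_atTop.comp tendsto_natCast_atTop_atTop)
      simpa using (this.mul_const t).div_const 2
    have hl : Tendsto (fun k : ℕ => -t ^ 2 / 2 * Real.sinc ((√k)⁻¹ * t / 2) ^ 2) atTop
        (𝓝 (-t ^ 2 / 2)) := by
      have := ((Real.continuous_sinc.tendsto 0).comp hs).pow 2 |>.const_mul (-t ^ 2 / 2)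
      simpa using this
    refine hl.congr' ?_
    filter_upwards [eventually_gt_atTop 0] with k hk
    have hk' : (0 : ℝ) < k := by exact_mod_cast hk
    have hsin : ∀ v : ℝ, Real.sin v = v * Real.sinc v := by
      intro v
      rcases eq_or_ne v 0 with rfl | hv
      · simp
      · rw [Real.sinc_of_ne_zero hv]; field_simp
    have hcos : Real.cos ((√k)⁻¹ * t) = 1 - 2 * Real.sin ((√k)⁻¹ * t / 2) ^ 2 := by
      rw [← Real.cos_sq_add_sin_sq ((√k)⁻¹ * t / 2)]
      have := Real.cos_two_mul ((√k)⁻¹ * t / 2)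
      rw [mul_div_cancel₀ _ two_ne_zero] at this
      rw [this]
      nlinarith [Real.cos_sq_add_sin_sq ((√k)⁻¹ * t / 2)]
    rw [hcos, hsin]
    have := Real.sq_sqrt hk'.le
    have hpos : 0 < √(k : ℝ) := Real.sqrt_pos.2 hk'
    field_simp
    rw [this]
    ring
  refine (Real.tendsto_one_add_pow_exp_of_tendsto h).congr fun k => ?_
  simp

/-- The central limit theorem for independent signs in `ℝⁿ`. -/
lemma tendsto_integral_cubeLaw {n : ℕ} {g : EuclideanSpace ℝ (Fin n) → ℝ} (hg : Continuous g)
    {C : ℝ} (hC : ∀ x, |g x| ≤ C) :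
    Tendsto (fun k => 𝔼 x, g (cubeSum n k x)) atTop
      (𝓝 (∫ z, g z ∂(stdGaussian (EuclideanSpace ℝ (Fin n))))) := by
  let μ₀ : ProbabilityMeasure (EuclideanSpace ℝ (Fin n)) := ⟨stdGaussian _, inferInstance⟩
  let μ : ℕ → ProbabilityMeasure (EuclideanSpace ℝ (Fin n)) := fun k =>
    ⟨cubeLaw n k, inferInstance⟩
  have h : Tendsto μ atTop (𝓝 μ₀) := by
    rw [ProbabilityMeasure.tendsto_iff_tendsto_charFun]
    intro t
    change Tendsto (fun k => charFun (cubeLaw n k) t) atTop (𝓝 (charFun (stdGaussian _) t))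
    simp_rw [charFun_cubeLaw]
    have : Complex.exp (-(‖t‖ : ℂ) ^ 2 / 2) = ((∏ j, Real.exp (-t j ^ 2 / 2) : ℝ) : ℂ) := by
      rw [← Real.exp_sum, ← Complex.ofReal_pow, EuclideanSpace.real_norm_sq_eq, ← Finset.sum_div,
        Finset.sum_neg_distrib]
      push_cast
      rfl
    rw [charFun_stdGaussian, this]
    exact (Complex.continuous_ofReal.tendsto _).comp
      (tendsto_finsetProd _ fun j _ => tendsto_cos_pow (t j))
  rw [ProbabilityMeasure.tendsto_iff_forall_integral_tendsto] at h
  have := h (BoundedContinuousFunction.ofNormedAddCommGroup g hg C hC)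
  refine this.congr fun k => ?_
  exact integral_cubeLaw_eq_expect hg

end

section

open Filter Topology BigOperators

lemma exists_cubeSum_update (n k : ℕ) (x : Fin n × Fin k → Bool) (P : Fin n × Fin k) (b : Bool) :
    ∃ s : ℝ, |s| ≤ 2 * (√k)⁻¹ ∧ (b = x P → s = 0) ∧
      cubeSum n k (Function.update x P b) = cubeSum n k x + EuclideanSpace.single P.1 s := by
  obtain ⟨j, i⟩ := P
  refine ⟨(√k)⁻¹ * (boolSign b - boolSign (x (j, i))), ?_, ?_, ?_⟩
  · rw [abs_mul, abs_of_nonneg (by positivity), mul_comm]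
    gcongr
    cases b <;> cases x (j, i) <;> norm_num [boolSign]
  · rintro rfl; simp
  · ext l
    simp only [cubeSum, PiLp.add_apply, PiLp.single_apply]
    split_ifs with h
    · subst h
      rw [← mul_add]
      congr 1
      have h1 : ∀ i', boolSign (Function.update x (l, i) b (l, i')) =
          boolSign (x (l, i')) + if i' = i then boolSign b - boolSign (x (l, i)) else 0 := by
        intro i'
        split_ifs with h
        · subst h; simp
        · rw [Function.update_of_ne (by simp [h])]; simp
      simp_rw [h1, Finset.sum_add_distrib]
      simp
    · rw [add_zero]
      congr 1
      refine Finset.sum_congr rfl fun i' _ => ?_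
      rw [Function.update_of_ne (by simp [h])]

lemma sq_update_difference_le {n k : ℕ} (hk : 0 < k) {f : EuclideanSpace ℝ (Fin n) → ℝ}
    {g : EuclideanSpace ℝ (Fin n)} {C L : ℝ} (hC : 0 ≤ C)
    (x : Fin n × Fin k → Bool)
    (hg : ∀ v, |f (cubeSum n k x + v) - f (cubeSum n k x) - inner ℝ g v| ≤ C * ‖v‖ ^ 2)
    (hgL : ‖g‖ ≤ L) (P : Fin n × Fin k) :
    ((f (cubeSum n k (Function.update x P true)) -
      f (cubeSum n k (Function.update x P false))) / 2) ^ 2 ≤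
      g P.1 ^ 2 / k + (4 * C * L + 4 * C ^ 2) / k * (√k)⁻¹ := by
  set r := (√(k : ℝ))⁻¹ with hr
  have hk' : (1 : ℝ) ≤ k := by exact_mod_cast hk
  have hr0 : 0 < r := by positivity
  have hr1 : r ≤ 1 := inv_le_one_of_one_le₀ (Real.one_le_sqrt.2 hk')
  have hr2 : r ^ 2 = (k : ℝ)⁻¹ := by rw [hr, inv_pow, Real.sq_sqrt (by positivity)]
  have hgP : |g P.1| ≤ L := (PiLp.norm_apply_le g P.1).trans hgL
  have hone : ∀ s : ℝ, |s| ≤ 2 * r →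
      |f (cubeSum n k x + EuclideanSpace.single P.1 s) - f (cubeSum n k x)| ≤
        2 * r * |g P.1| + C * (4 * r ^ 2) := by
    intro s hs
    have h := hg (EuclideanSpace.single P.1 s)
    have hinner : inner ℝ g (EuclideanSpace.single P.1 s) = s * g P.1 := by
      simp [EuclideanSpace.inner_single_right]
    rw [hinner] at h
    have hn : ‖EuclideanSpace.single P.1 s‖ ^ 2 ≤ 4 * r ^ 2 := by
      simp only [PiLp.norm_single, Real.norm_eq_abs]
      nlinarith [abs_nonneg s]
    have h2 : C * ‖EuclideanSpace.single P.1 s‖ ^ 2 ≤ C * (4 * r ^ 2) := by gcongr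
    have h3 : |s * g P.1| ≤ 2 * r * |g P.1| := by rw [abs_mul]; gcongr
    have h4 := abs_add_le (f (cubeSum n k x + EuclideanSpace.single P.1 s) - f (cubeSum n k x)
      - s * g P.1) (s * g P.1)
    rw [sub_add_cancel] at h4
    linarith
  have hD : |f (cubeSum n k (Function.update x P true)) -
      f (cubeSum n k (Function.update x P false))| ≤ 2 * r * |g P.1| + C * (4 * r ^ 2) := by
    obtain ⟨s, hs, hs0, hse⟩ := exists_cubeSum_update n k x P true
    obtain ⟨t, ht, ht0, hte⟩ := exists_cubeSum_update n k x P false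
    have hz : EuclideanSpace.single P.1 (0 : ℝ) = 0 := PiLp.single_eq_zero_iff _ _ |>.2 rfl
    rw [hse, hte]
    cases h : x P
    · rw [ht0 h.symm, hz]
      simpa using hone s hs
    · rw [hs0 h.symm, hz, abs_sub_comm]
      simpa using hone t ht
  have h5 : |(f (cubeSum n k (Function.update x P true)) -
      f (cubeSum n k (Function.update x P false))) / 2| ≤ r * |g P.1| + 2 * C * r ^ 2 := by
    rw [abs_div, abs_two]; linarith
  rw [← sq_abs]
  refine (pow_le_pow_left₀ (abs_nonneg _) h5 2).trans ?_
  have h6 : C * |g P.1| * r ^ 3 ≤ C * L * r ^ 3 := by gcongr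
  have h7 : C ^ 2 * r ^ 4 ≤ C ^ 2 * r ^ 3 :=
    mul_le_mul_of_nonneg_left (pow_le_pow_of_le_one hr0.le hr1 (by norm_num)) (sq_nonneg _)
  rw [div_eq_mul_inv, div_eq_mul_inv, ← hr2, ← sq_abs (g P.1)]
  nlinarith

lemma sqrt_add_le_sqrt_add_sqrt {a b : ℝ} (ha : 0 ≤ a) (hb : 0 ≤ b) : √(a + b) ≤ √a + √b := by
  refine Real.sqrt_le_left (by positivity) |>.2 ?_
  nlinarith [Real.sq_sqrt ha, Real.sq_sqrt hb, mul_nonneg (Real.sqrt_nonneg a) (Real.sqrt_nonneg b)]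

lemma gaussProfile_le_one (x : ℝ) : gaussProfile x ≤ 1 := stdDensity_le_one _

lemma continuousAt_gaussProfile {x : ℝ} (hx : x ∈ Set.Ioo (0 : ℝ) 1) :
    ContinuousAt gaussProfile x :=
  continuous_stdDensity.continuousAt.comp (continuousAt_stdQuantile hx)

/-- Bobkov's Gaussian isoperimetric inequality, for functions whose gradient is controlled by
their isoperimetric profile. -/
lemma gaussProfile_integral_le {n : ℕ} {f : EuclideanSpace ℝ (Fin n) → ℝ}
    {g : EuclideanSpace ℝ (Fin n) → EuclideanSpace ℝ (Fin n)} {C L : ℝ} (hC : 0 ≤ C) (hL : 0 ≤ L)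
    (hf : Continuous f) (hf01 : ∀ x, f x ∈ Set.Ioo (0 : ℝ) 1)
    (hmean : ∫ x, f x ∂(stdGaussian (EuclideanSpace ℝ (Fin n))) ∈ Set.Ioo (0 : ℝ) 1)
    (hg : ∀ x v, |f (x + v) - f x - inner ℝ (g x) v| ≤ C * ‖v‖ ^ 2)
    (hgL : ∀ x, ‖g x‖ ≤ L * gaussProfile (f x)) :
    gaussProfile (∫ x, f x ∂(stdGaussian (EuclideanSpace ℝ (Fin n)))) ≤
      √(1 + L ^ 2) * ∫ x, gaussProfile (f x) ∂(stdGaussian (EuclideanSpace ℝ (Fin n))) := by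
  have hcg : Continuous fun x => gaussProfile (f x) :=
    continuous_iff_continuousAt.2 fun x =>
      (continuousAt_gaussProfile (hf01 x)).comp hf.continuousAt
  have hgp0 : ∀ x, 0 ≤ gaussProfile (f x) := fun x => (gaussProfile_pos _).le
  have l1 := tendsto_integral_cubeLaw hf (C := 1)
    (fun x => abs_le.2 ⟨by linarith [(hf01 x).1], (hf01 x).2.le⟩)
  have l2 := tendsto_integral_cubeLaw hcg (C := 1)
    (fun x => abs_le.2 ⟨by linarith [hgp0 x], gaussProfile_le_one _⟩)
  set K : ℝ := n * (4 * C * L + 4 * C ^ 2) with hK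
  have hK0 : 0 ≤ K := by positivity
  have l3 : Tendsto (fun k : ℕ => √(K * (√(k : ℝ))⁻¹)) atTop (𝓝 0) := by
    have h1 : Tendsto (fun k : ℕ => (√(k : ℝ))⁻¹) atTop (𝓝 0) :=
      tendsto_inv_atTop_zero.comp (Real.tendsto_sqrt_atTop.comp tendsto_natCast_atTop_atTop)
    have h2 := (h1.const_mul K).sqrt
    simpa using h2
  have l4 := (l2.const_mul √(1 + L ^ 2)).add l3
  rw [add_zero] at l4
  refine le_of_tendsto_of_tendsto ((continuousAt_gaussProfile hmean).tendsto.comp l1) l4 ?_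
  filter_upwards [eventually_gt_atTop 0] with k hk
  refine (gaussProfile_cube (fun x => f (cubeSum n k x)) fun x => hf01 _).trans ?_
  rw [Finset.mul_expect]
  have hkk : (0 : ℝ) < k := by exact_mod_cast hk
  have hpt : ∀ x : Fin n × Fin k → Bool,
      √(gaussProfile (f (cubeSum n k x)) ^ 2 + ∑ P, ((f (cubeSum n k (Function.update x P true)) -
        f (cubeSum n k (Function.update x P false))) / 2) ^ 2) ≤
      √(1 + L ^ 2) * gaussProfile (f (cubeSum n k x)) + √(K * (√(k : ℝ))⁻¹) := by
    intro x
    set G := gaussProfile (f (cubeSum n k x)) with hG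
    have hG0 : 0 ≤ G := hgp0 _
    have hG1 : G ≤ 1 := gaussProfile_le_one _
    have hgx : ‖g (cubeSum n k x)‖ ≤ L * G := hgL _
    have hgx' : ‖g (cubeSum n k x)‖ ≤ L := hgx.trans (mul_le_of_le_one_right hL hG1)
    have hsum : ∑ P, ((f (cubeSum n k (Function.update x P true)) -
        f (cubeSum n k (Function.update x P false))) / 2) ^ 2 ≤
        ‖g (cubeSum n k x)‖ ^ 2 + K * (√(k : ℝ))⁻¹ := by
      refine (Finset.sum_le_sum fun P _ =>
        sq_update_difference_le hk hC x (hg _) hgx' P).trans (le_of_eq ?_)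
      rw [Finset.sum_add_distrib, Fintype.sum_prod_type, EuclideanSpace.norm_sq_eq]
      simp only [Finset.sum_const, Finset.card_univ, Fintype.card_fin, Fintype.card_prod,
        nsmul_eq_mul, Real.norm_eq_abs, sq_abs]
      push_cast
      congr 1
      · exact Finset.sum_congr rfl fun j _ => by field_simp
      · rw [hK]; field_simp
    rw [← Real.sqrt_sq hG0, ← Real.sqrt_mul (by positivity), Real.sq_sqrt (sq_nonneg _)]
    refine (Real.sqrt_le_sqrt ?_).trans (sqrt_add_le_sqrt_add_sqrt ?_ ?_)
    · have := pow_le_pow_left₀ (norm_nonneg _) hgx 2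
      nlinarith
    · positivity
    · positivity
  calc _ ≤ 𝔼 x : Fin n × Fin k → Bool,
        (√(1 + L ^ 2) * gaussProfile (f (cubeSum n k x)) + √(K * (√(k : ℝ))⁻¹)) :=
        Finset.expect_le_expect fun x _ => hpt x
    _ = _ := by
        rw [Finset.expect_add_distrib, Finset.expect_const Finset.univ_nonempty]

end

section

open Filter Topology BigOperators

section Mollify

open scoped Convolution
open ContinuousLinearMap

variable {G W W' : Type*} [NormedAddCommGroup G] [InnerProductSpace ℝ G] [FiniteDimensional ℝ G]
  [MeasurableSpace G] [BorelSpace G] [NormedAddCommGroup W] [NormedSpace ℝ W]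
  [NormedAddCommGroup W'] [NormedSpace ℝ W']

lemma norm_convolution_sub_le (B : W →L[ℝ] ℝ →L[ℝ] W') {ψ : G → W} {F : G → ℝ}
    (hψ : Continuous ψ) (hcψ : HasCompactSupport ψ) (hF : LipschitzWith 1 F) (x y : G) :
    ‖(ψ ⋆[B, volume] F) x - (ψ ⋆[B, volume] F) y‖ ≤ ‖B‖ * (∫ t, ‖ψ t‖) * ‖x - y‖ := by
  have he := hcψ.convolutionExists_left B hψ
    (hF.continuous.locallyIntegrable (μ := (volume : Measure G)))
  have hi : Integrable (fun t => ‖ψ t‖) := (hψ.integrable_of_hasCompactSupport hcψ).norm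
  rw [convolution, convolution, ← integral_sub (he x).integrable (he y).integrable]
  calc _ ≤ ∫ t, ‖B‖ * ‖x - y‖ * ‖ψ t‖ := by
        refine norm_integral_le_of_norm_le (hi.const_mul _) (ae_of_all _ fun t => ?_)
        rw [← map_sub]
        refine (B.le_opNorm₂ _ _).trans ?_
        have := hF.dist_le_mul (x - t) (y - t)
        rw [dist_eq_norm, dist_eq_norm, sub_sub_sub_cancel_right] at this
        simp only [NNReal.coe_one, one_mul] at this
        calc _ ≤ ‖B‖ * ‖ψ t‖ * ‖x - y‖ := by gcongr
          _ = _ := by ring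
    _ = _ := by rw [integral_const_mul]; ring

lemma exists_norm_convolution_sub_le (B : W →L[ℝ] ℝ →L[ℝ] W') {ψ : G → W} {F : G → ℝ}
    (hψ : Continuous ψ) (hcψ : HasCompactSupport ψ) (hF : LipschitzWith 1 F) :
    ∃ C : ℝ, 0 ≤ C ∧ ∀ x y,
      ‖(ψ ⋆[B, volume] F) x - (ψ ⋆[B, volume] F) y‖ ≤ C * ‖x - y‖ :=
  ⟨‖B‖ * ∫ t, ‖ψ t‖, by positivity, norm_convolution_sub_le B hψ hcψ hF⟩

/-- A Lipschitz function is uniformly close to Lipschitz functions with a Lipschitz gradient. -/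
lemma exists_smooth_approx {F : G → ℝ} (hF : LipschitzWith 1 F) {η : ℝ} (hη : 0 < η) :
    ∃ (H : G → ℝ) (g : G → G) (C : ℝ), 0 ≤ C ∧ LipschitzWith 1 H ∧ (∀ x, ‖g x‖ ≤ 1) ∧
      (∀ x v, |H (x + v) - H x - inner ℝ (g x) v| ≤ C * ‖v‖ ^ 2) ∧ ∀ x, |H x - F x| ≤ η := by
  let φ : ContDiffBump (0 : G) := ⟨η / 2, η, by linarith, by linarith⟩
  let B := lsmul ℝ ℝ (E := ℝ)
  set ψ := φ.normed volume with hψ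
  have hsm : ContDiff ℝ 1 ψ := φ.contDiff_normed
  have hcs : HasCompactSupport ψ := φ.hasCompactSupport_normed
  set H := ψ ⋆[B, volume] F with hH
  set D := fderiv ℝ ψ ⋆[B.precompL G, volume] F with hD
  have hder : ∀ x, HasFDerivAt H (D x) x := fun x =>
    hcs.hasFDerivAt_convolution_left B hsm hF.continuous.locallyIntegrable x
  have hHl : LipschitzWith 1 H := by
    refine LipschitzWith.of_dist_le_mul fun x y => ?_
    rw [dist_eq_norm, dist_eq_norm]
    refine (norm_convolution_sub_le B hsm.continuous hcs hF x y).trans ?_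
    have h1 : ∫ t, ‖ψ t‖ = 1 := by
      simp_rw [hψ, fun t => Real.norm_of_nonneg (φ.nonneg_normed (μ := volume) t)]
      exact φ.integral_normed
    rw [h1, mul_one]
    gcongr
    exact opNorm_lsmul_le
  obtain ⟨C, hC, hDl⟩ : ∃ C : ℝ, 0 ≤ C ∧ ∀ x y, ‖D x - D y‖ ≤ C * ‖x - y‖ :=
    exists_norm_convolution_sub_le (B.precompL G) (hsm.continuous_fderiv one_ne_zero)
      (hcs.fderiv ℝ) hF
  refine ⟨H, fun x => (InnerProductSpace.toDual ℝ G).symm (D x), C, hC, hHl,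
    fun x => ?_, fun x v => ?_, fun x => ?_⟩
  · rw [LinearIsometryEquiv.norm_map, ← (hder x).fderiv]
    simpa using norm_fderiv_le_of_lipschitz ℝ hHl (x₀ := x)
  · rw [InnerProductSpace.toDual_symm_apply]
    have := (convex_closedBall x ‖v‖).norm_image_sub_le_of_norm_hasFDerivWithin_le'
      (f := H) (f' := D) (φ := D x) (C := C * ‖v‖) (x := x) (y := x + v)
      (fun y _ => (hder y).hasFDerivWithinAt)
      (fun y hy => (hDl y x).trans (by
        rw [← dist_eq_norm]
        exact mul_le_mul_of_nonneg_left (Metric.mem_closedBall.1 hy) hC))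
      (by simp) (by simp)
    rw [add_sub_cancel_left] at this
    rw [← Real.norm_eq_abs]
    linarith
  · rw [← Real.dist_eq]
    refine φ.dist_normed_convolution_le hF.continuous.aestronglyMeasurable fun y hy => ?_
    refine (hF.dist_le_mul y x).trans ?_
    simpa using (Metric.mem_ball.1 hy).le

end Mollify

end

section

open Filter Topology BigOperators

lemma abs_stdDensity_sub_le (a b : ℝ) : |stdDensity b - stdDensity a| ≤ |b - a| := by
  have := convex_univ.norm_image_sub_le_of_norm_hasDerivWithin_le (C := 1) (x := a) (y := b)
    (fun t _ => (hasDerivAt_stdDensity t).hasDerivWithinAt)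
    (fun t _ => by simpa [neg_mul, abs_neg] using abs_mul_stdDensity_le_one t)
    (Set.mem_univ _) (Set.mem_univ _)
  simpa using this

lemma abs_stdPhi_sub_sub_le (a b : ℝ) :
    |stdPhi b - stdPhi a - stdDensity a * (b - a)| ≤ (b - a) ^ 2 := by
  have := (convex_closedBall a |b - a|).norm_image_sub_le_of_norm_hasDerivWithin_le
    (f := fun t => stdPhi t - stdDensity a * t) (f' := fun t => stdDensity t - stdDensity a)
    (C := |b - a|) (x := a) (y := b)
    (fun t _ => ((hasDerivAt_stdPhi t).sub
      (((hasDerivAt_id t).const_mul (stdDensity a)).congr_deriv (by simp))).hasDerivWithinAt)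
    (fun t ht => (abs_stdDensity_sub_le a t).trans (by simpa [Real.dist_eq] using ht))
    (by simp) (by simp [Real.dist_eq])
  rw [Real.norm_eq_abs, Real.norm_eq_abs, ← sq, sq_abs] at this
  convert this using 2
  ring

section Concentration

variable {n : ℕ} {H : EuclideanSpace ℝ (Fin n) → ℝ}
  {g : EuclideanSpace ℝ (Fin n) → EuclideanSpace ℝ (Fin n)} {C ε : ℝ}

lemma integrable_stdPhi_comp (hH : Continuous H) (μ : Measure (EuclideanSpace ℝ (Fin n)))
    [IsFiniteMeasure μ] : Integrable (fun x => stdPhi (H x)) μ :=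
  Integrable.of_bound (continuous_stdPhi.comp hH).aestronglyMeasurable 1
    (ae_of_all _ fun x => by
      rw [Real.norm_of_nonneg (stdPhi_pos _).le]; exact (stdPhi_lt_one _).le)

lemma integral_stdPhi_mem_Ioo (hH : Continuous H) (μ : Measure (EuclideanSpace ℝ (Fin n)))
    [IsProbabilityMeasure μ] : ∫ x, stdPhi (H x) ∂μ ∈ Set.Ioo (0 : ℝ) 1 := by
  have key : ∀ {K : EuclideanSpace ℝ (Fin n) → ℝ}, Continuous K → 0 < ∫ x, stdPhi (K x) ∂μ := by
    intro K hK
    rw [integral_pos_iff_support_of_nonneg (fun x => (stdPhi_pos _).le)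
      (integrable_stdPhi_comp hK μ)]
    have : Function.support (fun x => stdPhi (K x)) = Set.univ :=
      Set.eq_univ_of_forall fun x => (stdPhi_pos _).ne'
    rw [this]; simp
  refine ⟨key hH, ?_⟩
  have h1 := key hH.neg
  have h2 : ∀ x, stdPhi (-H x) = 1 - stdPhi (H x) := fun x => by
    linarith [stdPhi_add_stdPhi_neg (H x)]
  simp only [Pi.neg_apply, h2] at h1
  rw [integral_sub (integrable_const _) (integrable_stdPhi_comp hH μ)] at h1
  simp at h1
  linarith

lemma hasDerivAt_integral_stdPhi (hH : Continuous H) (μ : Measure (EuclideanSpace ℝ (Fin n)))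
    [IsProbabilityMeasure μ] (hε : 0 < ε) (s : ℝ) :
    HasDerivAt (fun s => ∫ x, stdPhi ((s - H x) / ε) ∂μ)
      (ε⁻¹ * ∫ x, stdDensity ((s - H x) / ε) ∂μ) s := by
  rw [← integral_const_mul]
  refine (hasDerivAt_integral_of_dominated_loc_of_deriv_le (μ := μ) (x₀ := s) (s := Set.univ)
    (F := fun s x => stdPhi ((s - H x) / ε))
    (F' := fun s x => ε⁻¹ * stdDensity ((s - H x) / ε)) (bound := fun _ => ε⁻¹)
    univ_mem ?_ ?_ ?_ ?_ (integrable_const (μ := μ) ε⁻¹) ?_).2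
  · exact Eventually.of_forall fun t =>
      (continuous_stdPhi.comp (by fun_prop : Continuous fun x => (t - H x) / ε)).aestronglyMeasurable
  · exact integrable_stdPhi_comp (by fun_prop) μ
  · exact ((continuous_stdDensity.comp
      (by fun_prop : Continuous fun x => (s - H x) / ε)).const_mul _).aestronglyMeasurable
  · refine ae_of_all _ fun x t _ => ?_
    rw [norm_mul, Real.norm_of_nonneg (by positivity), Real.norm_of_nonneg (stdDensity_pos _).le]
    exact mul_le_of_le_one_right (by positivity) (stdDensity_le_one _)
  · refine ae_of_all _ fun x t _ => ?_
    refine ((hasDerivAt_stdPhi _).comp t (((hasDerivAt_id t).sub_const (H x)).div_const ε)).congr_deriv ?_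
    simp; ring

lemma gaussProfile_integral_stdPhi_le (hC : 0 ≤ C) (hHl : LipschitzWith 1 H)
    (hg1 : ∀ x, ‖g x‖ ≤ 1)
    (hg : ∀ x v, |H (x + v) - H x - inner ℝ (g x) v| ≤ C * ‖v‖ ^ 2) (hε : 0 < ε) (s : ℝ) :
    gaussProfile (∫ x, stdPhi ((s - H x) / ε) ∂(stdGaussian (EuclideanSpace ℝ (Fin n)))) ≤
      √(1 + ε ^ 2) * (ε⁻¹ *
        ∫ x, stdDensity ((s - H x) / ε) ∂(stdGaussian (EuclideanSpace ℝ (Fin n)))) := by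
  have hc : Continuous fun x => (s - H x) / ε := by
    have := hHl.continuous
    fun_prop
  have := gaussProfile_integral_le (f := fun x => stdPhi ((s - H x) / ε))
    (g := fun x => (-(ε⁻¹ * stdDensity ((s - H x) / ε))) • g x) (C := ε⁻¹ ^ 2 + ε⁻¹ * C) (L := ε⁻¹)
    (by positivity) (by positivity) (continuous_stdPhi.comp hc)
    (fun x => ⟨stdPhi_pos _, stdPhi_lt_one _⟩) (integral_stdPhi_mem_Ioo hc _) ?_ ?_
  · simp only [gaussProfile_stdPhi] at this
    convert this using 1
    rw [← mul_assoc]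
    congr 1
    rw [← Real.sqrt_sq (inv_pos.2 hε).le, ← Real.sqrt_mul (by positivity),
      Real.sqrt_sq (inv_pos.2 hε).le]
    congr 1
    field_simp
    ring
  · intro x v
    set a := (s - H x) / ε
    set b := (s - H (x + v)) / ε with hb
    set d := stdDensity a
    have hd0 : 0 < d := stdDensity_pos _
    have hd1 : d ≤ 1 := stdDensity_le_one _
    have hba : b - a = -(ε⁻¹ * (H (x + v) - H x)) := by simp only [a, b]; ring
    have h1 := abs_stdPhi_sub_sub_le a b
    have h2 : (b - a) ^ 2 ≤ ε⁻¹ ^ 2 * ‖v‖ ^ 2 := by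
      rw [hba, neg_sq, mul_pow]
      have h3 := hHl.dist_le_mul (x + v) x
      simp only [NNReal.coe_one, one_mul, dist_eq_norm, add_sub_cancel_left] at h3
      exact mul_le_mul_of_nonneg_left (sq_le_sq.2 (by simpa using h3)) (by positivity)
    rw [inner_smul_left]
    simp only [conj_trivial]
    have h4 : stdPhi b - stdPhi a - -(ε⁻¹ * d) * inner ℝ (g x) v =
        (stdPhi b - stdPhi a - d * (b - a)) -
          ε⁻¹ * d * (H (x + v) - H x - inner ℝ (g x) v) := by
      rw [hba]; ring
    rw [h4]
    refine (abs_sub _ _).trans ?_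
    rw [abs_mul, abs_of_pos (by positivity : 0 < ε⁻¹ * d)]
    have h5 : ε⁻¹ * d * |H (x + v) - H x - inner ℝ (g x) v| ≤ ε⁻¹ * 1 * (C * ‖v‖ ^ 2) := by
      gcongr
      exact hg x v
    linarith
  · intro x
    rw [gaussProfile_stdPhi, norm_smul, norm_neg, Real.norm_of_nonneg
      (mul_nonneg (inv_pos.2 hε).le (stdDensity_pos _).le)]
    exact mul_le_of_le_one_right (mul_nonneg (inv_pos.2 hε).le (stdDensity_pos _).le) (hg1 x)

/-- The quantile of the smoothed distribution function grows at least linearly. -/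
lemma stdQuantile_integral_stdPhi_add_le (hC : 0 ≤ C) (hHl : LipschitzWith 1 H)
    (hg1 : ∀ x, ‖g x‖ ≤ 1)
    (hg : ∀ x v, |H (x + v) - H x - inner ℝ (g x) v| ≤ C * ‖v‖ ^ 2) (hε : 0 < ε)
    {s t : ℝ} (ht : 0 ≤ t) :
    stdQuantile (∫ x, stdPhi ((s - H x) / ε) ∂(stdGaussian (EuclideanSpace ℝ (Fin n)))) + t ≤
      stdQuantile (∫ x, stdPhi ((s + √(1 + ε ^ 2) * t - H x) / ε)
        ∂(stdGaussian (EuclideanSpace ℝ (Fin n)))) := by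
  set γ := stdGaussian (EuclideanSpace ℝ (Fin n))
  set K := √(1 + ε ^ 2)
  have hK : 0 < K := by positivity
  have hmem : ∀ s, ∫ x, stdPhi ((s - H x) / ε) ∂γ ∈ Set.Ioo (0 : ℝ) 1 := fun s =>
    integral_stdPhi_mem_Ioo (by have := hHl.continuous; fun_prop) γ
  have hd : ∀ s, HasDerivAt (fun s => stdQuantile (∫ x, stdPhi ((s - H x) / ε) ∂γ) - s / K)
      ((gaussProfile (∫ x, stdPhi ((s - H x) / ε) ∂γ))⁻¹ *
        (ε⁻¹ * ∫ x, stdDensity ((s - H x) / ε) ∂γ) - 1 / K) s := fun s =>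
    ((hasDerivAt_stdQuantile (hmem s)).comp s
      (hasDerivAt_integral_stdPhi hHl.continuous γ hε s)).fun_sub ((hasDerivAt_id s).div_const K)
  have hm : Monotone fun s => stdQuantile (∫ x, stdPhi ((s - H x) / ε) ∂γ) - s / K := by
    refine monotone_of_deriv_nonneg (fun s => (hd s).differentiableAt) fun s => ?_
    rw [(hd s).deriv, sub_nonneg, inv_mul_eq_div, div_le_div_iff₀ hK (gaussProfile_pos _), one_mul]
    refine (gaussProfile_integral_stdPhi_le hC hHl hg1 hg hε s).trans (le_of_eq ?_)
    ring
  have := hm (show s ≤ s + K * t by nlinarith)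
  dsimp only at this
  rw [add_div, mul_div_cancel_left₀ _ hK.ne'] at this
  linarith

end Concentration

end

section

open Filter Topology BigOperators

section Concentration

variable {n : ℕ} {F : EuclideanSpace ℝ (Fin n) → ℝ}

lemma stdPhi_stdQuantile_add_le (hF : LipschitzWith 1 F) {m : ℝ}
    (hm : 1 / 2 ≤ (stdGaussian (EuclideanSpace ℝ (Fin n))).real {x | F x ≤ m})
    {t : ℝ} (ht : 0 ≤ t) {r : ℝ} (hr : 0 < r) :
    stdPhi (stdQuantile (1 / 2 * stdPhi r⁻¹) + t) ≤
      (stdGaussian (EuclideanSpace ℝ (Fin n))).real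
        {x | F x ≤ m + (4 * r + √(1 + (r ^ 2) ^ 2) * t)} + stdPhi (-r⁻¹) := by
  obtain ⟨H, g, C, hC, hHl, hg1, hg, hHF⟩ := exists_smooth_approx hF hr
  set γ := stdGaussian (EuclideanSpace ℝ (Fin n))
  have hHc := hHl.continuous
  have hε : 0 < r ^ 2 := by positivity
  have hmeas : ∀ a, MeasurableSet {x | F x ≤ a} := fun a =>
    measurableSet_le hF.continuous.measurable measurable_const
  have hintg : ∀ s, Integrable (fun x => stdPhi ((s - H x) / r ^ 2)) γ := fun s =>
    integrable_stdPhi_comp (by fun_prop) γ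
  have hlow : 1 / 2 * stdPhi r⁻¹ ≤ ∫ x, stdPhi ((m + 2 * r - H x) / r ^ 2) ∂γ := by
    calc 1 / 2 * stdPhi r⁻¹ ≤ γ.real {x | F x ≤ m} * stdPhi r⁻¹ := by
          gcongr; exact (stdPhi_pos _).le
      _ = ∫ x, {x | F x ≤ m}.indicator (fun _ => stdPhi r⁻¹) x ∂γ := by
          rw [integral_indicator_const _ (hmeas m), smul_eq_mul]
      _ ≤ _ := by
          refine integral_mono ((integrable_const _).indicator (hmeas m)) (hintg _) fun x => ?_
          refine Set.indicator_apply_le' (fun hx => ?_) (fun _ => (stdPhi_pos _).le)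
          refine strictMono_stdPhi.monotone ?_
          have h1 := (abs_le.1 (hHF x)).2
          have hx' : F x ≤ m := hx
          rw [le_div_iff₀ hε]
          field_simp
          linarith
  have hup : ∀ s, ∫ x, stdPhi ((s - H x) / r ^ 2) ∂γ ≤
      γ.real {x | F x ≤ s + 2 * r} + stdPhi (-r⁻¹) := by
    intro s
    calc _ ≤ ∫ x, ({x | F x ≤ s + 2 * r}.indicator (fun _ => (1 : ℝ)) x + stdPhi (-r⁻¹)) ∂γ := by
          refine integral_mono (hintg _) (((integrable_const _).indicator (hmeas _)).add
            (integrable_const _)) fun x => ?_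
          by_cases hx : F x ≤ s + 2 * r
          · dsimp only
            rw [Set.indicator_of_mem (by exact hx)]
            linarith [stdPhi_lt_one ((s - H x) / r ^ 2), stdPhi_pos (-r⁻¹)]
          · dsimp only
            rw [Set.indicator_of_notMem (by exact hx), zero_add]
            refine strictMono_stdPhi.monotone ?_
            have h1 := (abs_le.1 (hHF x)).1
            rw [div_le_iff₀ hε]
            field_simp
            linarith
      _ = _ := by
          rw [integral_add ((integrable_const _).indicator (hmeas _)) (integrable_const _),
            integral_indicator_const _ (hmeas _)]
          simp
  have hmem : ∀ s, ∫ x, stdPhi ((s - H x) / r ^ 2) ∂γ ∈ Set.Ioo (0 : ℝ) 1 := fun s =>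
    integral_stdPhi_mem_Ioo (by fun_prop) γ
  have hmem' : 1 / 2 * stdPhi r⁻¹ ∈ Set.Ioo (0 : ℝ) 1 :=
    ⟨mul_pos (by norm_num) (stdPhi_pos _), by linarith [stdPhi_lt_one r⁻¹]⟩
  have hq := stdQuantile_integral_stdPhi_add_le hC hHl hg1 hg hε (s := m + 2 * r) ht
  calc _ ≤ stdPhi (stdQuantile (∫ x, stdPhi ((m + 2 * r + √(1 + (r ^ 2) ^ 2) * t - H x) / r ^ 2)
          ∂γ)) := by
        refine strictMono_stdPhi.monotone (le_trans ?_ hq)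
        gcongr
        exact stdQuantile_strictMonoOn.monotoneOn hmem' (hmem _) hlow
    _ = _ := stdPhi_stdQuantile (hmem _)
    _ ≤ _ := by
        refine (hup _).trans (le_of_eq ?_)
        congr 4
        ext x
        ring_nf

/-- Gaussian concentration: Lipschitz functions of a standard Gaussian vector exceed their median
no more than a standard Gaussian variable does. -/
lemma stdPhi_le_stdGaussian_real (hF : LipschitzWith 1 F) {m : ℝ}
    (hm : 1 / 2 ≤ (stdGaussian (EuclideanSpace ℝ (Fin n))).real {x | F x ≤ m})
    {t : ℝ} (ht : 0 ≤ t) :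
    stdPhi t ≤ (stdGaussian (EuclideanSpace ℝ (Fin n))).real {x | F x ≤ m + t} := by
  set γ := stdGaussian (EuclideanSpace ℝ (Fin n))
  have hgt : ∀ u > t, stdPhi t ≤ γ.real {x | F x ≤ m + u} := by
    intro u hu
    have hinv : Tendsto (fun r : ℝ => r⁻¹) (𝓝[>] 0) atTop := tendsto_inv_nhdsGT_zero
    have h1 : Tendsto (fun r : ℝ => 1 / 2 * stdPhi r⁻¹) (𝓝[>] 0) (𝓝 (1 / 2)) := by
      simpa using (tendsto_stdPhi_atTop.comp hinv).const_mul (1 / 2 : ℝ)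
    have h2 : stdQuantile (1 / 2) = 0 := by rw [← stdPhi_zero, stdQuantile_stdPhi]
    have h3 : Tendsto (fun r : ℝ => stdPhi (stdQuantile (1 / 2 * stdPhi r⁻¹) + t)) (𝓝[>] 0)
        (𝓝 (stdPhi t)) := by
      have h4 := ((continuousAt_stdQuantile (x := 1 / 2) ⟨by norm_num, by norm_num⟩).tendsto.comp
        h1).add_const t
      rw [h2, zero_add] at h4
      exact (continuous_stdPhi.tendsto t).comp h4
    have h5 : Tendsto (fun r : ℝ => γ.real {x | F x ≤ m + u} + stdPhi (-r⁻¹)) (𝓝[>] 0)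
        (𝓝 (γ.real {x | F x ≤ m + u})) := by
      simpa using (tendsto_stdPhi_atBot.comp
        (tendsto_neg_atTop_atBot.comp hinv)).const_add (γ.real {x | F x ≤ m + u})
    have h6 : Tendsto (fun r : ℝ => 4 * r + √(1 + (r ^ 2) ^ 2) * t) (𝓝[>] 0) (𝓝 t) := by
      have : Continuous fun r : ℝ => 4 * r + √(1 + (r ^ 2) ^ 2) * t := by fun_prop
      have h7 := this.tendsto 0
      simp at h7
      exact h7.mono_left nhdsWithin_le_nhds
    refine le_of_tendsto_of_tendsto h3 h5 ?_
    filter_upwards [h6.eventually_le_const hu, self_mem_nhdsWithin] with r hr hr0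
    refine (stdPhi_stdQuantile_add_le hF hm ht hr0).trans ?_
    refine add_le_add (measureReal_mono fun x hx => ?_) le_rfl
    have hx' : F x ≤ _ := hx
    exact hx'.trans (by linarith)
  have hprob : IsProbabilityMeasure (γ.map F) :=
    Measure.isProbabilityMeasure_map hF.continuous.aemeasurable
  have hcdf : ∀ a, cdf (γ.map F) a = γ.real {x | F x ≤ a} := fun a => by
    rw [cdf_eq_real, map_measureReal_apply hF.continuous.measurable measurableSet_Iic]; rfl
  have hrc := ((cdf (γ.map F)).right_continuous (m + t)).mono Set.Ioi_subset_Ici_self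
  rw [← hcdf]
  refine ge_of_tendsto hrc.tendsto ?_
  filter_upwards [self_mem_nhdsWithin] with u hu
  rw [hcdf]
  have := hgt (u - m) (by have : m + t < u := hu; linarith)
  simpa using this

end Concentration

end

section

open Filter Topology BigOperators

lemma gaussianVec_eq_pi (n : ℕ) (σ : ℝ) :
    gaussianVec n σ = Measure.pi fun _ => gaussianReal 0 (NNReal.mk (σ ^ 2) (sq_nonneg σ)) :=
  rfl

lemma gaussianVec_eq_map (n : ℕ) (σ : ℝ) :
    gaussianVec n σ = (stdGaussian (EuclideanSpace ℝ (Fin n))).map fun z i => σ * z i := by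
  have h1 : (fun z : EuclideanSpace ℝ (Fin n) => fun i => σ * z i) ∘ WithLp.toLp 2 =
      fun x i => σ * x i := by ext; rfl
  have h2 : (gaussianReal 0 1).map (fun x => σ * x) =
      gaussianReal 0 (NNReal.mk (σ ^ 2) (sq_nonneg σ)) := by
    simpa using gaussianReal_map_const_mul (μ := 0) (v := 1) σ
  rw [← map_pi_eq_stdGaussian, Measure.map_map (by fun_prop) (by fun_prop), h1,
    Measure.pi_map_pi (fun i => by fun_prop), h2, gaussianVec_eq_pi]

instance (n : ℕ) (σ : ℝ) : IsProbabilityMeasure (gaussianVec n σ) := by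
  rw [gaussianVec_eq_pi]; infer_instance

section Lipschitz

variable {n : ℕ} {F : (Fin n → ℝ) → ℝ}

lemma scaledNorm_eq_norm_div (u : Fin n → ℝ) :
    scaledNorm u = ‖WithLp.toLp 2 u‖ / √n := by
  rw [scaledNorm, EuclideanSpace.norm_eq, Real.sqrt_div (by positivity)]
  simp

lemma continuous_of_abs_sub_le_scaledNorm (hF : ∀ x y, |F x - F y| ≤ scaledNorm (x - y)) :
    Continuous F := by
  refine continuous_iff_continuousAt.2 fun y => tendsto_iff_dist_tendsto_zero.2 ?_
  have h1 : Continuous fun x => scaledNorm (x - y) := by unfold scaledNorm; fun_prop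
  have h2 := h1.tendsto y
  simp only [sub_self] at h2
  rw [show scaledNorm (0 : Fin n → ℝ) = 0 by simp [scaledNorm]] at h2
  exact squeeze_zero (fun _ => dist_nonneg) (fun x => hF x y) h2

lemma stdPhi_le_gaussianVec_real (hn : 0 < n) {σ : ℝ} (hσ : 0 < σ)
    (hF : ∀ x y, |F x - F y| ≤ scaledNorm (x - y)) {m : ℝ}
    (hm : 1 / 2 ≤ (gaussianVec n σ).real {x | F x ≤ m}) {t : ℝ} (ht : 0 ≤ t) :
    stdPhi t ≤ (gaussianVec n σ).real {x | F x ≤ m + σ * t / √n} := by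
  have hn' : 0 < √(n : ℝ) := by positivity
  have hFc := continuous_of_abs_sub_le_scaledNorm hF
  set G : EuclideanSpace ℝ (Fin n) → ℝ := fun z => √n / σ * F fun i => σ * z i with hG
  have hGl : LipschitzWith 1 G := by
    refine LipschitzWith.of_dist_le_mul fun x y => ?_
    rw [Real.dist_eq, dist_eq_norm, NNReal.coe_one, one_mul, hG]
    dsimp only
    rw [← mul_sub, abs_mul, abs_of_pos (by positivity)]
    have h1 := hF (fun i => σ * x i) (fun i => σ * y i)
    have h2 : scaledNorm ((fun i => σ * x i) - fun i => σ * y i) = σ * ‖x - y‖ / √n := by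
      rw [scaledNorm_eq_norm_div]
      congr 1
      rw [← abs_of_pos hσ, ← Real.norm_eq_abs, ← norm_smul, Real.norm_eq_abs, abs_of_pos hσ]
      congr 1
      ext i
      simp [mul_sub]
    rw [h2] at h1
    calc _ ≤ √n / σ * (σ * ‖x - y‖ / √n) := by gcongr
      _ = ‖x - y‖ := by field_simp
  have hset : ∀ a, (gaussianVec n σ).real {x | F x ≤ a} =
      (stdGaussian (EuclideanSpace ℝ (Fin n))).real {z | G z ≤ √n / σ * a} := by
    intro a
    rw [gaussianVec_eq_map, map_measureReal_apply (by fun_prop)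
      (measurableSet_le hFc.measurable measurable_const)]
    congr 1
    ext z
    have : 0 < √n / σ := by positivity
    simp only [Set.preimage_ofPred_eq, Set.mem_ofPred_eq, hG, mul_le_mul_iff_right₀ this]
  rw [hset] at hm ⊢
  convert stdPhi_le_stdGaussian_real hGl hm ht using 4
  field_simp

lemma lintegral_ofReal_gaussianReal :
    ∫⁻ s, ENNReal.ofReal s ∂(gaussianReal 0 1) = ENNReal.ofReal (√(2 * Real.pi))⁻¹ := by
  have hder : ∀ x ∈ Set.Ici (0 : ℝ), HasDerivAt (fun t => -stdDensity t) (stdDensity x * x) x :=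
    fun x _ => (hasDerivAt_stdDensity x).fun_neg.congr_deriv (by ring)
  have hpos : ∀ x ∈ Set.Ioi (0 : ℝ), 0 ≤ stdDensity x * x := fun x hx =>
    mul_nonneg (stdDensity_pos x).le (le_of_lt hx)
  have hlim : Tendsto (fun t => -stdDensity t) atTop (𝓝 0) := by
    have h1 : Tendsto (fun t : ℝ => t ^ 2 / 2) atTop atTop :=
      (tendsto_pow_atTop two_ne_zero).atTop_div_const two_pos
    have h2 := ((Real.tendsto_exp_neg_atTop_nhds_zero.comp h1).const_mul
      (√(2 * Real.pi))⁻¹).neg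
    simp only [mul_zero, neg_zero] at h2
    refine h2.congr fun t => ?_
    simp [stdDensity, neg_div]
  calc _ = ∫⁻ s in Set.Ioi 0, ENNReal.ofReal s ∂(gaussianReal 0 1) := by
        rw [← lintegral_indicator measurableSet_Ioi]
        refine lintegral_congr fun s => ?_
        by_cases hs : s ∈ Set.Ioi (0 : ℝ)
        · rw [Set.indicator_of_mem hs]
        · rw [Set.indicator_of_notMem hs, ENNReal.ofReal_of_nonpos (not_lt.1 hs)]
    _ = ∫⁻ s in Set.Ioi 0, ENNReal.ofReal (stdDensity s * s) := by
        rw [gaussianReal_of_var_ne_zero _ one_ne_zero,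
          setLIntegral_withDensity_eq_setLIntegral_mul _ (by fun_prop) (by fun_prop)
            measurableSet_Ioi]
        refine lintegral_congr fun s => ?_
        rw [stdDensity_eq_gaussianPDFReal, ENNReal.ofReal_mul (gaussianPDFReal_nonneg _ _ _)]
        rfl
    _ = ENNReal.ofReal (∫ s in Set.Ioi 0, stdDensity s * s) :=
        (ofReal_integral_eq_lintegral_ofReal (integrableOn_Ioi_deriv_of_nonneg' hder hpos hlim)
          ((ae_restrict_iff' measurableSet_Ioi).2 (ae_of_all _ hpos))).symm
    _ = _ := by
        rw [integral_Ioi_of_hasDerivAt_of_nonneg' hder hpos hlim]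
        simp [stdDensity]

lemma gaussianReal_Ioi (t : ℝ) : gaussianReal 0 1 (Set.Ioi t) = 1 - ENNReal.ofReal (stdPhi t) := by
  rw [← Set.compl_Iic, prob_compl_eq_one_sub measurableSet_Iic, stdPhi,
    ENNReal.ofReal_toReal (measure_ne_top _ _)]

lemma lintegral_gaussianVec_le (hn : 0 < n) {σ : ℝ} (hσ : 0 < σ)
    (hF : ∀ x y, |F x - F y| ≤ scaledNorm (x - y)) {m : ℝ}
    (hm : 1 / 2 ≤ (gaussianVec n σ).real {x | F x ≤ m}) :
    ∫⁻ x, ENNReal.ofReal (F x) ∂(gaussianVec n σ) ≤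
      ENNReal.ofReal m + ENNReal.ofReal (σ / √(2 * Real.pi * n)) := by
  have hFc := (continuous_of_abs_sub_le_scaledNorm hF)
  set c := σ / √n with hc
  have hc0 : 0 < c := by positivity
  have hmeas : ∀ a, MeasurableSet {x | F x ≤ a} := fun a =>
    measurableSet_le hFc.measurable measurable_const
  have htail : ∫⁻ x, ENNReal.ofReal (F x - m) ∂(gaussianVec n σ) ≤
      ∫⁻ s, ENNReal.ofReal (c * s) ∂(gaussianReal 0 1) := by
    have e1 : ∀ x : ℝ, ENNReal.ofReal x = ENNReal.ofReal (max x 0) := fun x => by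
      rcases le_total x 0 with h | h <;> simp [h]
    simp_rw [fun x => e1 (F x - m), fun s => e1 (c * s)]
    rw [lintegral_eq_lintegral_meas_lt (f := fun x => max (F x - m) 0) _
        (ae_of_all _ fun _ => le_max_right _ _) (by fun_prop),
      lintegral_eq_lintegral_meas_lt (f := fun s => max (c * s) 0) _
        (ae_of_all _ fun _ => le_max_right _ _) (by fun_prop)]
    refine setLIntegral_mono' measurableSet_Ioi fun t ht => ?_
    have ht' : (0 : ℝ) < t := ht
    have s1 : {x | t < max (F x - m) 0} = {x | F x ≤ m + t}ᶜ := by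
      ext x
      simp only [lt_max_iff, Set.mem_ofPred_eq, Set.mem_compl_iff, not_le, not_lt.2 ht'.le, or_false]
      constructor <;> intro h <;> linarith
    have s2 : {s | t < max (c * s) 0} = Set.Ioi (t / c) := by
      ext x
      simp only [lt_max_iff, Set.mem_ofPred_eq, Set.mem_Ioi, not_lt.2 ht'.le, or_false,
        div_lt_iff₀ hc0, mul_comm]
    rw [s1, s2, gaussianReal_Ioi, prob_compl_eq_one_sub (hmeas _)]
    refine tsub_le_tsub_left ?_ _
    have := stdPhi_le_gaussianVec_real hn hσ hF hm (t := t / c) (by positivity)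
    rw [show σ * (t / c) / √n = t by rw [hc]; field_simp] at this
    exact (ENNReal.ofReal_le_iff_le_toReal (measure_ne_top _ _)).2 this
  calc _ ≤ ∫⁻ x, (ENNReal.ofReal m + ENNReal.ofReal (F x - m)) ∂(gaussianVec n σ) := by
        refine lintegral_mono fun x => ?_
        refine le_trans (le_of_eq ?_) ENNReal.ofReal_add_le
        rw [add_sub_cancel]
    _ = ENNReal.ofReal m + ∫⁻ x, ENNReal.ofReal (F x - m) ∂(gaussianVec n σ) := by
        rw [lintegral_add_left measurable_const]; simp
    _ ≤ _ := by
        gcongr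
        refine htail.trans (le_of_eq ?_)
        simp_rw [ENNReal.ofReal_mul hc0.le]
        rw [lintegral_const_mul _ (by fun_prop), lintegral_ofReal_gaussianReal,
          ← ENNReal.ofReal_mul hc0.le, hc]
        congr 1
        rw [Real.sqrt_mul (by positivity) (n : ℝ), ← div_eq_mul_inv, div_div, mul_comm (√n)]

end Lipschitz

end

section

open Filter Topology BigOperators

section ConeNorm

variable {p : ℕ} {A : Set (Fin p → ℝ)}

lemma half_sum_nonneg {a β : Fin p → ℝ} (ha : ∀ j, 0 < a j) :
    0 ≤ (1 / 2) * ∑ j, (β j ^ 2 / a j + a j) := by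
  exact mul_nonneg (by norm_num)
    (Finset.sum_nonneg fun j _ => add_nonneg (div_nonneg (sq_nonneg _) (ha j).le) (ha j).le)

lemma coneNorm_le (hApos : ∀ a ∈ A, ∀ j, 0 < a j) (β : Fin p → ℝ) {a : Fin p → ℝ} (ha : a ∈ A) :
    coneNorm A β ≤ (1 / 2) * ∑ j, (β j ^ 2 / a j + a j) :=
  csInf_le ⟨0, by rintro r ⟨b, hb, rfl⟩; exact half_sum_nonneg (hApos b hb)⟩ ⟨a, ha, rfl⟩

lemma le_coneNorm (hAne : A.Nonempty) {β : Fin p → ℝ} {r : ℝ}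
    (h : ∀ a ∈ A, r ≤ (1 / 2) * ∑ j, (β j ^ 2 / a j + a j)) : r ≤ coneNorm A β := by
  obtain ⟨a, ha⟩ := hAne
  exact le_csInf ⟨_, a, ha, rfl⟩ (by rintro r ⟨b, hb, rfl⟩; exact h b hb)

lemma coneNorm_nonneg (hAne : A.Nonempty) (hApos : ∀ a ∈ A, ∀ j, 0 < a j) (β : Fin p → ℝ) :
    0 ≤ coneNorm A β :=
  le_coneNorm hAne fun a ha => half_sum_nonneg (hApos a ha)

lemma sum_abs_le_coneNorm (hAne : A.Nonempty) (hApos : ∀ a ∈ A, ∀ j, 0 < a j) (β : Fin p → ℝ) :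
    ∑ j, |β j| ≤ coneNorm A β := by
  refine le_coneNorm hAne fun a ha => ?_
  rw [Finset.mul_sum]
  refine Finset.sum_le_sum fun j _ => ?_
  have h := hApos a ha j
  rw [← sq_abs, div_add' _ _ _ h.ne', ← mul_div_assoc, le_div_iff₀ h]
  nlinarith [sq_nonneg (|β j| - a j)]

lemma coneNorm_pos (hAne : A.Nonempty) (hApos : ∀ a ∈ A, ∀ j, 0 < a j) {β : Fin p → ℝ}
    (hβ : β ≠ 0) : 0 < coneNorm A β := by
  obtain ⟨j, hj⟩ := Function.ne_iff.1 hβ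
  refine lt_of_lt_of_le ?_ (sum_abs_le_coneNorm hAne hApos β)
  exact Finset.sum_pos' (fun _ _ => abs_nonneg _) ⟨j, Finset.mem_univ _, abs_pos.2 hj⟩

lemma exists_lt_coneNorm_add (hAne : A.Nonempty) (β : Fin p → ℝ) {ε : ℝ} (hε : 0 < ε) :
    ∃ a ∈ A, (1 / 2) * ∑ j, (β j ^ 2 / a j + a j) < coneNorm A β + ε := by
  obtain ⟨a₀, ha₀⟩ := hAne
  obtain ⟨_, ⟨a, ha, rfl⟩, h⟩ := exists_lt_of_csInf_lt
    (s := {r | ∃ a ∈ A, r = (1 / 2) * ∑ j, (β j ^ 2 / a j + a j)}) ⟨_, a₀, ha₀, rfl⟩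
    (lt_add_of_pos_right (coneNorm A β) hε)
  exact ⟨a, ha, h⟩

lemma add_sq_div_add_le {x y a b : ℝ} (ha : 0 < a) (hb : 0 < b) :
    (x + y) ^ 2 / (a + b) ≤ x ^ 2 / a + y ^ 2 / b := by
  rw [div_add_div _ _ ha.ne' hb.ne', div_le_div_iff₀ (by positivity) (by positivity)]
  nlinarith [sq_nonneg (x * b - y * a)]

lemma coneNorm_add_le (hAne : A.Nonempty) (hApos : ∀ a ∈ A, ∀ j, 0 < a j) (hAconv : Convex ℝ A)
    (hAcone : ∀ c : ℝ, 0 < c → ∀ a ∈ A, c • a ∈ A) (β γ : Fin p → ℝ) :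
    coneNorm A (β + γ) ≤ coneNorm A β + coneNorm A γ := by
  refine le_of_forall_pos_le_add fun ε hε => ?_
  obtain ⟨a, ha, hβ⟩ := exists_lt_coneNorm_add hAne β (half_pos hε)
  obtain ⟨b, hb, hγ⟩ := exists_lt_coneNorm_add hAne γ (half_pos hε)
  have hab : a + b ∈ A := by
    have := hAcone 2 two_pos _ (hAconv ha hb (a := 1 / 2) (b := 1 / 2)
      (by norm_num) (by norm_num) (by norm_num))
    rwa [smul_add, smul_smul, smul_smul, mul_one_div_cancel two_ne_zero, one_smul,
      one_smul] at this
  have h := coneNorm_le hApos (β + γ) hab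
  have h2 : ∑ j, ((β + γ) j ^ 2 / (a + b) j + (a + b) j) ≤
      ∑ j, (β j ^ 2 / a j + a j) + ∑ j, (γ j ^ 2 / b j + b j) := by
    rw [← Finset.sum_add_distrib]
    refine Finset.sum_le_sum fun j _ => ?_
    have := add_sq_div_add_le (x := β j) (y := γ j) (hApos a ha j) (hApos b hb j)
    simp only [Pi.add_apply]
    linarith
  linarith

lemma coneNorm_smul_le (hAne : A.Nonempty) (hApos : ∀ a ∈ A, ∀ j, 0 < a j)
    (hAcone : ∀ c : ℝ, 0 < c → ∀ a ∈ A, c • a ∈ A) {c : ℝ} (hc : 0 < c) (β : Fin p → ℝ) :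
    coneNorm A (c • β) ≤ c * coneNorm A β := by
  rw [mul_comm, ← div_le_iff₀ hc]
  refine le_coneNorm hAne fun a ha => ?_
  rw [div_le_iff₀ hc]
  refine (coneNorm_le hApos _ (hAcone c hc a ha)).trans (le_of_eq ?_)
  rw [mul_assoc, Finset.sum_mul]
  congr 1
  refine Finset.sum_congr rfl fun j _ => ?_
  have := (hApos a ha j).ne'
  simp only [Pi.smul_apply, smul_eq_mul]
  field_simp

lemma coneNorm_neg (β : Fin p → ℝ) : coneNorm A (-β) = coneNorm A β := by
  simp [coneNorm]

lemma coneNorm_zero (hAne : A.Nonempty) (hApos : ∀ a ∈ A, ∀ j, 0 < a j)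
    (hAcone : ∀ c : ℝ, 0 < c → ∀ a ∈ A, c • a ∈ A) : coneNorm A 0 = 0 := by
  have h := coneNorm_smul_le hAne hApos hAcone (c := 1 / 2) (by norm_num) 0
  rw [smul_zero] at h
  linarith [coneNorm_nonneg hAne hApos 0]

lemma restr_add_restr_compl (S : Finset (Fin p)) (β : Fin p → ℝ) :
    restr S β + restr Sᶜ β = β := by
  ext j
  by_cases h : j ∈ S <;> simp [restr, h]

/-- The cone norm decomposes over admissible sets. -/
lemma Admissible.coneNorm_restr_add_le (hAne : A.Nonempty) (hApos : ∀ a ∈ A, ∀ j, 0 < a j)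
    {S : Finset (Fin p)} (hS : Admissible A S) (β : Fin p → ℝ) :
    coneNorm A (restr S β) + coneNorm A (restr Sᶜ β) ≤ coneNorm A β := by
  refine le_coneNorm hAne fun a ha => ?_
  refine le_of_forall_pos_le_add fun ε hε => ?_
  obtain ⟨bc, bs, hbc0, hbc, hbs0, hbs, h1, h2⟩ := hS a ha (ε / (p + 1)) (by positivity)
  have e1 := coneNorm_le hApos (restr S β) h1
  have e2 := coneNorm_le hApos (restr Sᶜ β) h2
  have hle : ∑ j, (restr S β j ^ 2 / (restr S a + bc) j + (restr S a + bc) j) +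
      ∑ j, (restr Sᶜ β j ^ 2 / (restr Sᶜ a + bs) j + (restr Sᶜ a + bs) j) ≤
      ∑ j, (β j ^ 2 / a j + a j) + ∑ _j : Fin p, ε / (p + 1) := by
    rw [← Finset.sum_add_distrib, ← Finset.sum_add_distrib]
    refine Finset.sum_le_sum fun j _ => ?_
    by_cases h : j ∈ S
    · simp [restr, h, hbc0 j h, (hbs j h).2.le]
    · simp [restr, h, hbs0 j h]
      linarith [(hbc j h).2.le]
  have hp : ∑ _j : Fin p, ε / ((p : ℝ) + 1) ≤ ε := by
    simp only [Finset.sum_const, Finset.card_univ, Fintype.card_fin, nsmul_eq_mul]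
    rw [← mul_div_assoc, div_le_iff₀ (by positivity)]
    nlinarith
  linarith

end ConeNorm

section Oracle

variable {n p : ℕ} {A : Set (Fin p → ℝ)} {X : Matrix (Fin n) (Fin p) ℝ} {lam : ℝ}

lemma scaledNorm_nonneg (u : Fin n → ℝ) : 0 ≤ scaledNorm u := Real.sqrt_nonneg _

lemma scaledNorm_sq (u : Fin n → ℝ) : scaledNorm u ^ 2 = (u ⬝ᵥ u) / n := by
  rw [scaledNorm, Real.sq_sqrt (by positivity)]
  simp [dotProduct, sq]

lemma dotProduct_div_le_scaledNorm_mul (u v : Fin n → ℝ) :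
    (u ⬝ᵥ v) / n ≤ scaledNorm u * scaledNorm v := by
  rcases Nat.eq_zero_or_pos n with rfl | hn
  · simp [scaledNorm]
  have hn' : (0 : ℝ) < n := by exact_mod_cast hn
  rw [scaledNorm, scaledNorm, Real.sqrt_div (by positivity), Real.sqrt_div (by positivity),
    div_mul_div_comm, Real.mul_self_sqrt hn'.le]
  gcongr
  exact Real.sum_mul_le_sqrt_mul_sqrt _ _ _

lemma abs_scaledNorm_sub_le (u v : Fin n → ℝ) :
    |scaledNorm u - scaledNorm v| ≤ scaledNorm (u - v) := by
  simp only [scaledNorm_eq_norm_div]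
  rw [← sub_div, abs_div, abs_of_nonneg (Real.sqrt_nonneg _), WithLp.toLp_sub]
  gcongr
  exact abs_norm_sub_norm_le _ _

/-- First-order optimality of a penalized least squares estimator. -/
lemma dotProduct_le_of_isMin (hAne : A.Nonempty) (hApos : ∀ a ∈ A, ∀ j, 0 < a j)
    (hAconv : Convex ℝ A) (hAcone : ∀ c : ℝ, 0 < c → ∀ a ∈ A, c • a ∈ A) (hl : 0 ≤ lam)
    {y : Fin n → ℝ} {β : Fin p → ℝ}
    (hmin : ∀ b, scaledNorm (y - X.mulVec β) ^ 2 + 2 * lam * coneNorm A β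
        ≤ scaledNorm (y - X.mulVec b) ^ 2 + 2 * lam * coneNorm A b) (b : Fin p → ℝ) :
    ((y - X.mulVec β) ⬝ᵥ X.mulVec (b - β)) / n ≤ lam * (coneNorm A b - coneNorm A β) := by
  set u := y - X.mulVec β with hu
  set d := X.mulVec (b - β) with hd
  have hstep : ∀ t ∈ Set.Ioo (0 : ℝ) 1,
      (u ⬝ᵥ d) / n ≤ lam * (coneNorm A b - coneNorm A β) + t * ((d ⬝ᵥ d) / n / 2) := by
    intro t ht
    have h := hmin ((1 - t) • β + t • b)
    have hc : coneNorm A ((1 - t) • β + t • b) ≤ (1 - t) * coneNorm A β + t * coneNorm A b :=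
      (coneNorm_add_le hAne hApos hAconv hAcone _ _).trans (add_le_add
        (coneNorm_smul_le hAne hApos hAcone (by linarith [ht.2]) _)
        (coneNorm_smul_le hAne hApos hAcone ht.1 _))
    have hx : y - X.mulVec ((1 - t) • β + t • b) = u - t • d := by
      rw [hu, hd, Matrix.mulVec_add, Matrix.mulVec_smul, Matrix.mulVec_smul, Matrix.mulVec_sub]
      module
    rw [hx, scaledNorm_sq, scaledNorm_sq] at h
    have he : (u - t • d) ⬝ᵥ (u - t • d) / n =
        (u ⬝ᵥ u) / n - 2 * t * ((u ⬝ᵥ d) / n) + t ^ 2 * ((d ⬝ᵥ d) / n) := by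
      simp only [sub_dotProduct, dotProduct_sub, smul_dotProduct, dotProduct_smul, smul_eq_mul,
        dotProduct_comm d u]
      ring
    rw [he] at h
    have hc' := mul_le_mul_of_nonneg_left hc hl
    have h3 : t * ((u ⬝ᵥ d) / n) ≤
        t * (lam * (coneNorm A b - coneNorm A β) + t * ((d ⬝ᵥ d) / n / 2)) := by
      nlinarith
    exact le_of_mul_le_mul_left h3 ht.1
  have hlim : Tendsto (fun t : ℝ => lam * (coneNorm A b - coneNorm A β) + t * ((d ⬝ᵥ d) / n / 2))
      (𝓝[>] 0) (𝓝 (lam * (coneNorm A b - coneNorm A β))) := by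
    have hcont : Continuous fun t : ℝ =>
        lam * (coneNorm A b - coneNorm A β) + t * ((d ⬝ᵥ d) / n / 2) := by fun_prop
    have h := hcont.tendsto 0
    simp only [zero_mul, add_zero] at h
    exact h.mono_left nhdsWithin_le_nhds
  refine ge_of_tendsto hlim ?_
  filter_upwards [Ioo_mem_nhdsGT one_pos] with t ht using hstep t ht

lemma scaledNorm_mulVec_sub_le_of_isMin (hAne : A.Nonempty) (hApos : ∀ a ∈ A, ∀ j, 0 < a j)
    (hAconv : Convex ℝ A) (hAcone : ∀ c : ℝ, 0 < c → ∀ a ∈ A, c • a ∈ A) (hl : 0 ≤ lam)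
    {βhat : (Fin n → ℝ) → Fin p → ℝ}
    (hmin : ∀ y b, scaledNorm (y - X.mulVec (βhat y)) ^ 2 + 2 * lam * coneNorm A (βhat y)
        ≤ scaledNorm (y - X.mulVec b) ^ 2 + 2 * lam * coneNorm A b) (y z : Fin n → ℝ) :
    scaledNorm (X.mulVec (βhat y) - X.mulVec (βhat z)) ≤ scaledNorm (y - z) := by
  have h1 := dotProduct_le_of_isMin hAne hApos hAconv hAcone hl (hmin y) (βhat z)
  have h2 := dotProduct_le_of_isMin hAne hApos hAconv hAcone hl (hmin z) (βhat y)
  set u := X.mulVec (βhat y) with hu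
  set v := X.mulVec (βhat z) with hv
  rw [Matrix.mulVec_sub, ← hu, ← hv] at h1 h2
  have h3 := dotProduct_div_le_scaledNorm_mul (y - z) (u - v)
  have h4 : scaledNorm (u - v) ^ 2 ≤ ((y - z) ⬝ᵥ (u - v)) / n := by
    rw [scaledNorm_sq]
    have : (y - z) ⬝ᵥ (u - v) / n - (u - v) ⬝ᵥ (u - v) / n =
        -((y - u) ⬝ᵥ (v - u) / n + (z - v) ⬝ᵥ (u - v) / n) := by
      simp only [sub_dotProduct, dotProduct_sub, dotProduct_comm v u]
      ring
    linarith
  by_contra! hlt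
  nlinarith [scaledNorm_nonneg (y - z), scaledNorm_nonneg (u - v)]

/-- The deterministic oracle inequality on the event that the noise is dominated by the penalty. -/
lemma scaledNorm_sub_le_oracle (hAne : A.Nonempty) (hApos : ∀ a ∈ A, ∀ j, 0 < a j)
    (hAconv : Convex ℝ A) (hAcone : ∀ c : ℝ, 0 < c → ∀ a ∈ A, c • a ∈ A) (hl : 0 < lam)
    {f ξ : Fin n → ℝ} {βh : Fin p → ℝ}
    (hmin : ∀ b, scaledNorm (f + ξ - X.mulVec βh) ^ 2 + 2 * lam * coneNorm A βh
        ≤ scaledNorm (f + ξ - X.mulVec b) ^ 2 + 2 * lam * coneNorm A b)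
    (hξ : ∀ Δ, (ξ ⬝ᵥ X.mulVec Δ) / n ≤ lam / 2 * coneNorm A Δ)
    {S : Finset (Fin p)} (hS : Admissible A S) {β : Fin p → ℝ} (hβ : Function.support β = ↑S)
    (hq : 0 < qASq X A S 3) :
    scaledNorm (X.mulVec βh - f) ≤
      scaledNorm (X.mulVec β - f) + 3 * lam / (2 * √(qASq X A S 3)) := by
  set Δ := βh - β with hΔ
  set NS := coneNorm A (restr S Δ) with hNS
  set NC := coneNorm A (restr Sᶜ Δ) with hNC
  have hNS0 : 0 ≤ NS := coneNorm_nonneg hAne hApos _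
  have hNC0 : 0 ≤ NC := coneNorm_nonneg hAne hApos _
  set q := √(qASq X A S 3) with hqdef
  have hq0 : 0 < q := Real.sqrt_pos.2 hq
  have hopt := dotProduct_le_of_isMin hAne hApos hAconv hAcone hl.le hmin β
  have hβ0 : ∀ j ∉ S, β j = 0 := fun j hj => by
    by_contra h
    exact hj (by exact_mod_cast hβ ▸ (show j ∈ Function.support β from h))
  have hN1 : coneNorm A Δ ≤ NS + NC := by
    rw [hNS, hNC, ← restr_add_restr_compl S Δ]
    simpa only [restr_add_restr_compl] using
      coneNorm_add_le hAne hApos hAconv hAcone (restr S Δ) (restr Sᶜ Δ)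
  have hN2 : coneNorm A β - NS + NC ≤ coneNorm A βh := by
    have h1 := hS.coneNorm_restr_add_le hAne hApos βh
    have h2 : restr Sᶜ βh = restr Sᶜ Δ := by
      ext j
      by_cases h : j ∈ S <;> simp [restr, h, hΔ, hβ0]
    have h3 : β = restr S βh + -restr S Δ := by
      ext j
      by_cases h : j ∈ S <;> simp [restr, h, hΔ, hβ0]
    have h4 := coneNorm_add_le hAne hApos hAconv hAcone (restr S βh) (-restr S Δ)
    rw [← h3, coneNorm_neg] at h4
    rw [h2] at h1
    linarith
  have hmain : scaledNorm (X.mulVec βh - f) ^ 2 + scaledNorm (X.mulVec Δ) ^ 2 ≤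
      scaledNorm (X.mulVec β - f) ^ 2 + 3 * lam * NS - lam * NC := by
    have h1 := hξ Δ
    have h2 : scaledNorm (X.mulVec βh - f) ^ 2 + scaledNorm (X.mulVec Δ) ^ 2 -
        scaledNorm (X.mulVec β - f) ^ 2 = 2 * ((f + ξ - X.mulVec βh) ⬝ᵥ X.mulVec (β - βh) / n) +
        2 * (ξ ⬝ᵥ X.mulVec Δ / n) := by
      simp only [scaledNorm_sq, hΔ, Matrix.mulVec_sub, sub_dotProduct, dotProduct_sub,
        add_dotProduct, dotProduct_comm (X.mulVec β) (X.mulVec βh), dotProduct_comm (X.mulVec β) f,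
        dotProduct_comm (X.mulVec βh) f]
      ring
    have h3 := mul_le_mul_of_nonneg_left hN1 hl.le
    have h4 := mul_le_mul_of_nonneg_left hN2 hl.le
    linarith
  set c := 3 * lam / (2 * q) with hcdef
  have hc0 : 0 < c := by positivity
  have hb0 := scaledNorm_nonneg (X.mulVec β - f)
  refine le_of_sq_le_sq ?_ (by positivity)
  by_cases hcone : NC ≤ 3 * NS ∧ restr S Δ ≠ 0
  · have hNSpos : 0 < NS := coneNorm_pos hAne hApos hcone.2
    have h1 : qASq X A S 3 ≤ scaledNorm (X.mulVec Δ) ^ 2 / NS ^ 2 :=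
      csInf_le ⟨0, by rintro r ⟨D, -, -, rfl⟩; positivity⟩ ⟨Δ, hcone.2, hcone.1, rfl⟩
    rw [le_div_iff₀ (by positivity), ← Real.sq_sqrt hq.le, ← hqdef, ← mul_pow] at h1
    have h2 := (le_abs_self _).trans (abs_le_of_sq_le_sq h1 (scaledNorm_nonneg _))
    have h3 : 3 * lam * NS = 2 * c * (q * NS) := by rw [hcdef]; field_simp
    have h4 : 2 * c * (q * NS) ≤ 2 * c * scaledNorm (X.mulVec Δ) := by gcongr
    nlinarith [sq_nonneg (c - scaledNorm (X.mulVec Δ)), mul_nonneg hb0 hc0.le]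
  · have h1 : 3 * NS ≤ NC := by
      by_cases h : restr S Δ = 0
      · rw [hNS, h, coneNorm_zero hAne hApos hAcone]; linarith
      · by_contra! h'
        exact hcone ⟨h'.le, h⟩
    have h2 := mul_le_mul_of_nonneg_left h1 hl.le
    nlinarith [sq_nonneg (scaledNorm (X.mulVec Δ)), mul_nonneg hb0 hc0.le]

end Oracle

end

section

open Filter Topology BigOperators

section DualBound

variable {p : ℕ} {A : Set (Fin p → ℝ)}

lemma isCompact_closure_inter_l1 (hApos : ∀ a ∈ A, ∀ j, 0 < a j) :
    IsCompact (closure (A ∩ {a | (∑ j, |a j|) ≤ 1})) := by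
  refine Bornology.IsBounded.isCompact_closure
    ((Metric.isBounded_Icc (0 : Fin p → ℝ) 1).subset ?_)
  rintro a ⟨haA, ha⟩
  refine ⟨fun j => (hApos a haA j).le, fun j => ?_⟩
  exact (le_abs_self _).trans
    ((Finset.single_le_sum (fun i _ => abs_nonneg (a i)) (Finset.mem_univ j)).trans ha)

lemma convex_l1_le_one : Convex ℝ {a : Fin p → ℝ | (∑ j, |a j|) ≤ 1} := by
  intro a ha b hb s t hs ht hst
  simp only [Set.mem_ofPred_eq] at ha hb ⊢
  calc ∑ j, |(s • a + t • b) j| ≤ ∑ j, (s * |a j| + t * |b j|) := by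
        refine Finset.sum_le_sum fun j _ => ?_
        simp only [Pi.add_apply, Pi.smul_apply, smul_eq_mul]
        refine (abs_add_le _ _).trans ?_
        rw [abs_mul, abs_mul, abs_of_nonneg hs, abs_of_nonneg ht]
    _ = s * (∑ j, |a j|) + t * ∑ j, |b j| := by
        rw [Finset.sum_add_distrib, Finset.mul_sum, Finset.mul_sum]
    _ ≤ s * 1 + t * 1 := by gcongr
    _ = 1 := by linarith

lemma nonneg_of_mem_closure_inter_l1 (hApos : ∀ a ∈ A, ∀ j, 0 < a j) {e : Fin p → ℝ}
    (he : e ∈ closure (A ∩ {a | (∑ j, |a j|) ≤ 1})) : (∀ j, 0 ≤ e j) ∧ ∑ j, e j ≤ 1 := by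
  have hcl : IsClosed {a : Fin p → ℝ | (∀ j, 0 ≤ a j) ∧ ∑ j, a j ≤ 1} := by
    simp only [Set.ofPred_and, Set.ofPred_forall]
    exact (isClosed_iInter fun j => isClosed_le continuous_const (continuous_apply j)).inter
      (isClosed_le (by fun_prop) continuous_const)
  refine closure_minimal ?_ hcl he
  rintro a ⟨haA, ha⟩
  exact ⟨fun j => (hApos a haA j).le, (Finset.sum_le_sum fun j _ => le_abs_self _).trans ha⟩

lemma smul_inv_mem_inter_l1 (hApos : ∀ a ∈ A, ∀ j, 0 < a j)
    (hAcone : ∀ (c : ℝ), 0 < c → ∀ a ∈ A, c • a ∈ A) {a : Fin p → ℝ} (ha : a ∈ A)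
    (hs : 0 < ∑ j, a j) : (∑ j, a j)⁻¹ • a ∈ A ∩ {a | (∑ j, |a j|) ≤ 1} := by
  refine ⟨hAcone _ (inv_pos.2 hs) a ha, ?_⟩
  simp only [Set.mem_ofPred_eq, Pi.smul_apply, smul_eq_mul, abs_mul, abs_of_pos (inv_pos.2 hs),
    abs_of_pos (hApos a ha _), ← Finset.mul_sum]
  exact (inv_mul_cancel₀ hs.ne').le

lemma extremePoints_inter_l1_nonempty (hAne : A.Nonempty) (hApos : ∀ a ∈ A, ∀ j, 0 < a j)
    (hAcone : ∀ (c : ℝ), 0 < c → ∀ a ∈ A, c • a ∈ A) :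
    (Set.extremePoints ℝ (closure (A ∩ {a | (∑ j, |a j|) ≤ 1}))).Nonempty := by
  refine (isCompact_closure_inter_l1 hApos).extremePoints_nonempty ?_
  obtain ⟨a, ha⟩ := hAne
  rcases (Finset.sum_nonneg fun j _ => (hApos a ha j).le : 0 ≤ ∑ j, a j).eq_or_lt with h | h
  · refine ⟨a, subset_closure ⟨ha, ?_⟩⟩
    simp only [Set.mem_ofPred_eq, abs_of_pos (hApos a ha _), ← h, zero_le_one]
  · exact ⟨_, subset_closure (smul_inv_mem_inter_l1 hApos hAcone ha h)⟩

/-- The dual norm of `coneNorm A` is controlled by the extremal points of the truncated cone. -/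
lemma dotProduct_le_mul_coneNorm (hAne : A.Nonempty) (hApos : ∀ a ∈ A, ∀ j, 0 < a j)
    (hAconv : Convex ℝ A) (hAcone : ∀ (c : ℝ), 0 < c → ∀ a ∈ A, c • a ∈ A)
    {v : Fin p → ℝ} {D : ℝ} (hD : 0 < D)
    (hv : ∀ e ∈ Set.extremePoints ℝ (closure (A ∩ {a | (∑ j, |a j|) ≤ 1})),
      ∑ j, e j * v j ^ 2 ≤ D ^ 2) (Δ : Fin p → ℝ) :
    v ⬝ᵥ Δ ≤ D * coneNorm A Δ := by
  have hall : ∀ a ∈ closure (A ∩ {a | (∑ j, |a j|) ≤ 1}), ∑ j, a j * v j ^ 2 ≤ D ^ 2 := by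
    rw [← closure_convexHull_extremePoints (isCompact_closure_inter_l1 hApos)
      (hAconv.inter convex_l1_le_one).closure]
    refine closure_minimal (t := {a : Fin p → ℝ | ∑ j, a j * v j ^ 2 ≤ D ^ 2}) (convexHull_min hv ?_)
      (isClosed_le (by fun_prop) continuous_const)
    intro a ha b hb s t hs ht hst
    simp only [Set.mem_ofPred_eq] at ha hb ⊢
    calc ∑ j, (s • a + t • b) j * v j ^ 2
        = s * (∑ j, a j * v j ^ 2) + t * ∑ j, b j * v j ^ 2 := by
          simp only [Pi.add_apply, Pi.smul_apply, smul_eq_mul, Finset.mul_sum,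
            ← Finset.sum_add_distrib]
          exact Finset.sum_congr rfl fun j _ => by ring
      _ ≤ s * D ^ 2 + t * D ^ 2 := by gcongr
      _ = D ^ 2 := by rw [← add_mul, hst, one_mul]
  rw [mul_comm, ← div_le_iff₀ hD]
  refine le_coneNorm hAne fun a ha => ?_
  rw [div_le_iff₀ hD]
  have h1 : ∑ j, a j * v j ^ 2 ≤ D ^ 2 * ∑ j, a j := by
    rcases (Finset.sum_nonneg fun j _ => (hApos a ha j).le : 0 ≤ ∑ j, a j).eq_or_lt with h | h
    · have hz : ∀ j, a j = 0 := fun j =>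
        (Finset.sum_eq_zero_iff_of_nonneg fun j _ => (hApos a ha j).le).1 h.symm j
          (Finset.mem_univ j)
      simp [hz]
    · have := hall _ (subset_closure (smul_inv_mem_inter_l1 hApos hAcone ha h))
      simp only [Pi.smul_apply, smul_eq_mul, mul_assoc, ← Finset.mul_sum] at this
      rwa [inv_mul_le_iff₀ h, mul_comm] at this
  have h2 : v ⬝ᵥ Δ ≤ ∑ j, (a j * v j ^ 2 / (2 * D) + D * (Δ j ^ 2 / a j) / 2) := by
    refine Finset.sum_le_sum fun j _ => ?_
    have ha' := hApos a ha j
    have : a j * v j ^ 2 / (2 * D) + D * (Δ j ^ 2 / a j) / 2 - v j * Δ j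
        = (a j * v j - D * Δ j) ^ 2 / (2 * D * a j) := by
      field_simp
      ring
    have h3 : 0 ≤ (a j * v j - D * Δ j) ^ 2 / (2 * D * a j) := by positivity
    linarith
  refine h2.trans ?_
  have h4 : (∑ j, a j * v j ^ 2) / (2 * D) ≤ D * (∑ j, a j) / 2 := by
    rw [div_le_div_iff₀ (by positivity) two_pos]
    nlinarith
  rw [Finset.sum_add_distrib, ← Finset.sum_div, ← Finset.sum_div, ← Finset.mul_sum,
    Finset.sum_add_distrib]
  linarith

end DualBound

section ChiSquare

lemma lintegral_exp_sq_gaussianReal_le {c : ℝ} (hc : 1 ≤ c) {v : NNReal} (hv : v ≤ 1) :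
    ∫⁻ x, ENNReal.ofReal (Real.exp ((1 - 1 / c ^ 2) / 2 * x ^ 2)) ∂gaussianReal 0 v
      ≤ ENNReal.ofReal c := by
  have hc0 : 0 < c := by linarith
  have hθ : 0 ≤ (1 - 1 / c ^ 2) / 2 := by
    have : 1 / c ^ 2 ≤ 1 := by rw [div_le_one (by positivity)]; nlinarith
    linarith
  have hmap : gaussianReal 0 v = (gaussianReal 0 1).map fun x => √(v : ℝ) * x := by
    rw [gaussianReal_map_const_mul, mul_zero, mul_one]
    congr 1
    ext
    simp
  rw [hmap, lintegral_map (by fun_prop) (by fun_prop)]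
  have hintg : Integrable fun x : ℝ => Real.exp (-(1 / (2 * c ^ 2)) * x ^ 2) :=
    integrable_exp_neg_mul_sq (by positivity)
  calc ∫⁻ x, ENNReal.ofReal (Real.exp ((1 - 1 / c ^ 2) / 2 * (√(v : ℝ) * x) ^ 2)) ∂gaussianReal 0 1
      ≤ ∫⁻ x, ENNReal.ofReal (Real.exp ((1 - 1 / c ^ 2) / 2 * x ^ 2)) ∂gaussianReal 0 1 := by
        refine lintegral_mono fun x => ENNReal.ofReal_le_ofReal (Real.exp_le_exp.2 ?_)
        refine mul_le_mul_of_nonneg_left ?_ hθ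
        rw [mul_pow, Real.sq_sqrt v.coe_nonneg]
        exact mul_le_of_le_one_left (sq_nonneg x) hv
    _ = ∫⁻ x, ENNReal.ofReal ((√(2 * Real.pi))⁻¹ * Real.exp (-(1 / (2 * c ^ 2)) * x ^ 2)) := by
        rw [gaussianReal_of_var_ne_zero 0 one_ne_zero,
          lintegral_withDensity_eq_lintegral_mul _ (measurable_gaussianPDF 0 1) (by fun_prop)]
        refine lintegral_congr fun x => ?_
        rw [Pi.mul_apply, gaussianPDF, ← ENNReal.ofReal_mul (gaussianPDFReal_nonneg 0 1 x),
          gaussianPDFReal, mul_assoc, ← Real.exp_add]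
        congr 2
        · simp
        · congr 1
          simp
          field_simp
          ring
    _ = ENNReal.ofReal c := by
        rw [← ofReal_integral_eq_lintegral_ofReal (hintg.const_mul _)
          (ae_of_all _ fun x => by positivity), integral_const_mul, integral_gaussian,
          show Real.pi / (1 / (2 * c ^ 2)) = 2 * Real.pi * c ^ 2 by field_simp,
          Real.sqrt_mul (by positivity) (c ^ 2), Real.sqrt_sq hc0.le, inv_mul_cancel_left₀]
        have := Real.pi_pos
        positivity

lemma exp_sum_mul_le {ι : Type*} [Fintype ι] {e y : ι → ℝ} (he : ∀ j, 0 ≤ e j)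
    (he1 : ∑ j, e j ≤ 1) :
    Real.exp (∑ j, e j * y j) ≤ ∑ j, e j * Real.exp (y j) + (1 - ∑ j, e j) := by
  set m := ∑ j, e j * y j with hm
  have key : ∀ x, Real.exp m * (1 + x - m) ≤ Real.exp x := fun x => by
    have h := Real.add_one_le_exp (x - m)
    calc Real.exp m * (1 + x - m) ≤ Real.exp m * Real.exp (x - m) := by
          gcongr; linarith
      _ = Real.exp x := by rw [← Real.exp_add]; congr 1; ring
  have h1 : ∑ j, e j * (Real.exp m * (1 + y j - m)) ≤ ∑ j, e j * Real.exp (y j) :=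
    Finset.sum_le_sum fun j _ => mul_le_mul_of_nonneg_left (key _) (he j)
  have h2 : ∑ j, e j * (Real.exp m * (1 + y j - m))
      = Real.exp m * ((1 - m) * ∑ j, e j + m) := by
    rw [hm, Finset.mul_sum, ← Finset.sum_add_distrib, Finset.mul_sum, ← hm]
    exact Finset.sum_congr rfl fun j _ => by ring
  have h3 := mul_le_mul_of_nonneg_left (key 0) (sub_nonneg.2 he1)
  rw [Real.exp_zero] at h3
  linarith

lemma map_inner_stdGaussian {ι : Type*} [Fintype ι] (u : EuclideanSpace ℝ ι) :
    (stdGaussian (EuclideanSpace ℝ ι)).map (fun z => inner ℝ u z)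
      = gaussianReal 0 (‖u‖ ^ 2).toNNReal := by
  have h := IsGaussian.map_eq_gaussianReal (μ := stdGaussian (EuclideanSpace ℝ ι)) (innerSL ℝ u)
  rw [integral_strongDual_stdGaussian, variance_dual_stdGaussian, innerSL_apply_norm] at h
  exact h

/-- Tail bound for a sub-convex combination of squares of Gaussian variables with variance at
most one. -/
lemma stdGaussian_real_sum_sq_le {ι κ : Type*} [Fintype ι] [Fintype κ]
    {u : κ → EuclideanSpace ℝ ι} (hu : ∀ j, ‖u j‖ ≤ 1) {e : κ → ℝ} (he : ∀ j, 0 ≤ e j)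
    (he1 : ∑ j, e j ≤ 1) {c : ℝ} (hc : 1 ≤ c) :
    (stdGaussian (EuclideanSpace ℝ ι)).real {z | c ^ 2 ≤ ∑ j, e j * inner ℝ (u j) z ^ 2}
      ≤ c * Real.exp (-((c ^ 2 - 1) / 2)) := by
  set μ := stdGaussian (EuclideanSpace ℝ ι)
  set θ := (1 - 1 / c ^ 2) / 2 with hθdef
  have hc0 : 0 < c := by linarith
  have hθ : 0 ≤ θ := by
    have : 1 / c ^ 2 ≤ 1 := by rw [div_le_one (by positivity)]; nlinarith
    linarith
  have hθc : θ * c ^ 2 = (c ^ 2 - 1) / 2 := by rw [hθdef]; field_simp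
  have h1 : ∫⁻ z, ENNReal.ofReal (Real.exp (θ * ∑ j, e j * inner ℝ (u j) z ^ 2)) ∂μ
      ≤ ENNReal.ofReal c := by
    calc ∫⁻ z, ENNReal.ofReal (Real.exp (θ * ∑ j, e j * inner ℝ (u j) z ^ 2)) ∂μ
        ≤ ∫⁻ z, (∑ j, ENNReal.ofReal (e j) * ENNReal.ofReal (Real.exp (θ * inner ℝ (u j) z ^ 2))
            + ENNReal.ofReal (1 - ∑ j, e j)) ∂μ := by
          refine lintegral_mono fun z => ?_
          have := exp_sum_mul_le (y := fun j => θ * inner ℝ (u j) z ^ 2) he he1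
          simp only [← ENNReal.ofReal_mul (he _)]
          rw [← ENNReal.ofReal_sum_of_nonneg fun j _ => mul_nonneg (he j) (Real.exp_pos _).le,
            ← ENNReal.ofReal_add
              (Finset.sum_nonneg fun j _ => mul_nonneg (he j) (Real.exp_pos _).le)
              (sub_nonneg.2 he1)]
          refine ENNReal.ofReal_le_ofReal (le_trans (le_of_eq ?_) this)
          rw [Finset.mul_sum]
          exact congrArg _ (Finset.sum_congr rfl fun j _ => by ring)
      _ = ∑ j, ENNReal.ofReal (e j)
            * ∫⁻ z, ENNReal.ofReal (Real.exp (θ * inner ℝ (u j) z ^ 2)) ∂μ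
            + ENNReal.ofReal (1 - ∑ j, e j) := by
          rw [lintegral_add_right _ measurable_const, lintegral_finsetSum _ (by fun_prop),
            lintegral_const, measure_univ, mul_one]
          congr 1
          exact Finset.sum_congr rfl fun j _ => lintegral_const_mul _ (by fun_prop)
      _ ≤ ∑ j, ENNReal.ofReal (e j) * ENNReal.ofReal c
            + ENNReal.ofReal (1 - ∑ j, e j) * ENNReal.ofReal c := by
          gcongr with j _
          · rw [← lintegral_map (μ := μ) (g := fun z => inner ℝ (u j) z)
              (f := fun x : ℝ => ENNReal.ofReal (Real.exp (θ * x ^ 2))) (by fun_prop)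
              (by fun_prop), map_inner_stdGaussian]
            refine lintegral_exp_sq_gaussianReal_le hc ?_
            rw [← NNReal.coe_le_coe, Real.coe_toNNReal _ (sq_nonneg _)]
            exact pow_le_one₀ (norm_nonneg _) (hu j)
          · exact le_mul_of_one_le_right zero_le (ENNReal.one_le_ofReal.2 hc)
      _ = ENNReal.ofReal c := by
          rw [← Finset.sum_mul, ← ENNReal.ofReal_sum_of_nonneg fun j _ => he j, ← add_mul,
            ← ENNReal.ofReal_add (Finset.sum_nonneg fun j _ => he j) (sub_nonneg.2 he1),
            add_sub_cancel, ENNReal.ofReal_one, one_mul]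
  have h2 := (mul_meas_ge_le_lintegral (μ := μ)
    (f := fun z => ENNReal.ofReal (Real.exp (θ * ∑ j, e j * inner ℝ (u j) z ^ 2)))
    (by fun_prop) (ENNReal.ofReal (Real.exp ((c ^ 2 - 1) / 2)))).trans h1
  have h3 : Real.exp ((c ^ 2 - 1) / 2)
      * μ.real {z | c ^ 2 ≤ ∑ j, e j * inner ℝ (u j) z ^ 2} ≤ c := by
    have hsub : {z | c ^ 2 ≤ ∑ j, e j * inner ℝ (u j) z ^ 2} ⊆
        {z | ENNReal.ofReal (Real.exp ((c ^ 2 - 1) / 2))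
          ≤ ENNReal.ofReal (Real.exp (θ * ∑ j, e j * inner ℝ (u j) z ^ 2))} := by
      intro z hz
      simp only [Set.mem_ofPred_eq] at hz ⊢
      refine ENNReal.ofReal_le_ofReal (Real.exp_le_exp.2 ?_)
      rw [← hθc]
      gcongr
    have h4 := ENNReal.toReal_mono ENNReal.ofReal_ne_top
      ((mul_le_mul_right (measure_mono (μ := μ) hsub) _).trans h2)
    rwa [ENNReal.toReal_mul, ENNReal.toReal_ofReal hc0.le,
      ENNReal.toReal_ofReal (Real.exp_pos _).le] at h4
  rw [Real.exp_neg, ← div_eq_mul_inv, le_div_iff₀ (Real.exp_pos _), mul_comm]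
  exact h3

end ChiSquare

end

section

open Filter Topology BigOperators

section Noise

lemma mul_exp_neg_le_exp_neg {t : ℝ} :
    (1 + t) * Real.exp (-(((1 + t) ^ 2 - 1) / 2)) ≤ Real.exp (-(t ^ 2 / 2)) := by
  have h : Real.exp (-(((1 + t) ^ 2 - 1) / 2)) = (Real.exp t)⁻¹ * Real.exp (-(t ^ 2 / 2)) := by
    rw [← Real.exp_neg, ← Real.exp_add]
    congr 1
    ring
  rw [h, ← mul_assoc]
  refine mul_le_of_le_one_left (Real.exp_pos _).le ?_
  rw [← div_eq_mul_inv, div_le_one (Real.exp_pos t)]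
  linarith [Real.add_one_le_exp t]

/-- With probability at least one half, `N` simultaneous weighted chi-square variables are bounded
by the square of `1 + √(2 log (2 N))`. -/
lemma half_le_stdGaussian_real_forall_lt {ι κ : Type*} [Fintype ι] [Fintype κ]
    {u : κ → EuclideanSpace ℝ ι} (hu : ∀ j, ‖u j‖ ≤ 1) {E : Finset (κ → ℝ)} (hEne : E.Nonempty)
    (hE0 : ∀ e ∈ E, ∀ j, 0 ≤ e j) (hE1 : ∀ e ∈ E, ∑ j, e j ≤ 1) :
    1 / 2 ≤ (stdGaussian (EuclideanSpace ℝ ι)).real {z | ∀ e ∈ E,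
      ∑ j, e j * inner ℝ (u j) z ^ 2 < (1 + √(2 * Real.log (2 * E.card))) ^ 2} := by
  set μ := stdGaussian (EuclideanSpace ℝ ι)
  obtain ⟨t, ht⟩ : ∃ t, t = √(2 * Real.log (2 * E.card)) := ⟨_, rfl⟩
  rw [← ht]
  have hcard : (1 : ℝ) ≤ E.card := by exact_mod_cast hEne.card_pos
  have hlog : 0 ≤ Real.log (2 * E.card) := Real.log_nonneg (by linarith)
  have hc : 1 ≤ 1 + t := by
    rw [ht]
    linarith [Real.sqrt_nonneg (2 * Real.log (2 * E.card))]
  have hexp : Real.exp (-(t ^ 2 / 2)) = (2 * (E.card : ℝ))⁻¹ := by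
    rw [ht, Real.sq_sqrt (by positivity), mul_div_cancel_left₀ _ two_ne_zero, Real.exp_neg,
      Real.exp_log (by positivity)]
  have hmeas : MeasurableSet {z : EuclideanSpace ℝ ι | ∀ e ∈ E,
      ∑ j, e j * inner ℝ (u j) z ^ 2 < (1 + t) ^ 2} := by
    have : {z : EuclideanSpace ℝ ι | ∀ e ∈ E, ∑ j, e j * inner ℝ (u j) z ^ 2 < (1 + t) ^ 2}
        = ⋂ e ∈ E, {z | ∑ j, e j * inner ℝ (u j) z ^ 2 < (1 + t) ^ 2} := by
      ext z; simp
    rw [this]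
    exact Finset.measurableSet_biInter _ fun e _ =>
      measurableSet_lt (by fun_prop) measurable_const
  have hcompl : {z : EuclideanSpace ℝ ι | ∀ e ∈ E,
      ∑ j, e j * inner ℝ (u j) z ^ 2 < (1 + t) ^ 2}ᶜ
      = ⋃ e ∈ E, {z | (1 + t) ^ 2 ≤ ∑ j, e j * inner ℝ (u j) z ^ 2} := by
    ext z; simp
  have h1 : μ.real {z : EuclideanSpace ℝ ι | ∀ e ∈ E,
      ∑ j, e j * inner ℝ (u j) z ^ 2 < (1 + t) ^ 2}ᶜ ≤ 1 / 2 := by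
    rw [hcompl]
    calc μ.real (⋃ e ∈ E, {z | (1 + t) ^ 2 ≤ ∑ j, e j * inner ℝ (u j) z ^ 2})
        ≤ ∑ e ∈ E, μ.real {z | (1 + t) ^ 2 ≤ ∑ j, e j * inner ℝ (u j) z ^ 2} :=
          measureReal_biUnion_finset_le E fun e => {z | (1 + t) ^ 2 ≤ ∑ j, e j * inner ℝ (u j) z ^ 2}
      _ ≤ ∑ e ∈ E, (2 * (E.card : ℝ))⁻¹ := Finset.sum_le_sum fun e he =>
          (stdGaussian_real_sum_sq_le hu (hE0 e he) (hE1 e he) hc).trans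
            (mul_exp_neg_le_exp_neg.trans hexp.le)
      _ = 1 / 2 := by
          rw [Finset.sum_const, nsmul_eq_mul]
          field_simp
  rw [probReal_compl_eq_one_sub hmeas] at h1
  linarith

variable {n p : ℕ} {A : Set (Fin p → ℝ)}

lemma one_half_le_gaussianVec_real_noise (hn : 0 < n) (hAne : A.Nonempty)
    (hApos : ∀ a ∈ A, ∀ j, 0 < a j) (hAconv : Convex ℝ A)
    (hAcone : ∀ (c : ℝ), 0 < c → ∀ a ∈ A, c • a ∈ A) {E : Finset (Fin p → ℝ)}
    (hE : (E : Set (Fin p → ℝ)) =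
      Set.extremePoints ℝ (closure (A ∩ {a | (∑ j, |a j|) ≤ 1})))
    {σ : ℝ} (hσ : 0 < σ) {X : Matrix (Fin n) (Fin p) ℝ}
    (hdiag : ∀ j : Fin p, (1 / n) * ∑ i, X i j ^ 2 ≤ 1) {lam : ℝ}
    (hlam : 2 * σ / √n * (1 + √(2 * Real.log (2 * E.card))) ≤ lam) {T : Set (Fin n → ℝ)}
    (hTm : MeasurableSet T)
    (hT : {ξ | ∀ Δ, (ξ ⬝ᵥ X.mulVec Δ) / n ≤ lam / 2 * coneNorm A Δ} ⊆ T) :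
    1 / 2 ≤ (gaussianVec n σ).real T := by
  have hn' : (0 : ℝ) < n := by exact_mod_cast hn
  set c := 1 + √(2 * Real.log (2 * E.card)) with hc
  have hc0 : 0 < c := by positivity
  set u : Fin p → EuclideanSpace ℝ (Fin n) := fun j => WithLp.toLp 2 fun i => X i j / √n
    with hu
  have hu1 : ∀ j, ‖u j‖ ≤ 1 := fun j => by
    rw [EuclideanSpace.norm_eq]
    refine Real.sqrt_le_one.2 (le_trans (le_of_eq ?_) (hdiag j))
    rw [Finset.mul_sum]
    refine Finset.sum_congr rfl fun i _ => ?_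
    rw [Real.norm_eq_abs, sq_abs, div_pow, Real.sq_sqrt hn'.le]
    ring
  have hEmem : ∀ e ∈ E, e ∈ Set.extremePoints ℝ (closure (A ∩ {a | (∑ j, |a j|) ≤ 1})) :=
    fun e he => hE ▸ Finset.mem_coe.2 he
  have hEne : E.Nonempty := by
    rw [← Finset.coe_nonempty, hE]
    exact extremePoints_inter_l1_nonempty hAne hApos hAcone
  refine (half_le_stdGaussian_real_forall_lt hu1 hEne
    (fun e he => (nonneg_of_mem_closure_inter_l1 hApos (hEmem e he).1).1)
    (fun e he => (nonneg_of_mem_closure_inter_l1 hApos (hEmem e he).1).2)).trans ?_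
  rw [gaussianVec_eq_map, map_measureReal_apply (by fun_prop) hTm]
  refine measureReal_mono fun z hz => hT ?_
  simp only [Set.mem_ofPred_eq] at hz ⊢
  intro Δ
  set v : Fin p → ℝ := fun j => σ / √n * inner ℝ (u j) z with hv
  have hvξ : ((fun i => σ * z i) ⬝ᵥ X.mulVec Δ) / n = v ⬝ᵥ Δ := by
    rw [Matrix.dotProduct_mulVec, dotProduct, dotProduct, Finset.sum_div]
    refine Finset.sum_congr rfl fun j _ => ?_
    rw [hv, Matrix.vecMul, dotProduct]
    simp only [hu, PiLp.inner_apply, RCLike.inner_apply, conj_trivial]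
    rw [Finset.mul_sum, Finset.sum_mul, Finset.sum_mul, Finset.sum_div]
    refine Finset.sum_congr rfl fun i _ => ?_
    have : √(n : ℝ) * √n = n := Real.mul_self_sqrt hn'.le
    have h0 : √(n : ℝ) ≠ 0 := by positivity
    generalize √(n : ℝ) = s at this h0 ⊢
    rw [← this]
    field_simp
  rw [hvξ]
  refine (dotProduct_le_mul_coneNorm hAne hApos hAconv hAcone (D := σ / √n * c) (by positivity)
    (fun e he => ?_) Δ).trans ?_
  · rw [← hE] at he
    have h1 := (hz e (Finset.mem_coe.1 he)).le
    rw [mul_pow]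
    calc ∑ j, e j * v j ^ 2 = (σ / √n) ^ 2 * ∑ j, e j * inner ℝ (u j) z ^ 2 := by
          rw [Finset.mul_sum]
          exact Finset.sum_congr rfl fun j _ => by rw [hv]; ring
      _ ≤ (σ / √n) ^ 2 * c ^ 2 := by gcongr
  · refine mul_le_mul_of_nonneg_right ?_ (coneNorm_nonneg hAne hApos Δ)
    have : 2 * σ / √n * c = 2 * (σ / √n * c) := by ring
    linarith

end Noise

end

/-- A prediction risk bounded by `M` on an event of probability at least one half obeys the
deviation and expectation bounds of a one-Lipschitz function of a Gaussian vector. -/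
lemma gaussianVec_deviation_and_expectation {n : ℕ} (hn : 0 < n) {σ : ℝ} (hσ : 0 < σ)
    {F : (Fin n → ℝ) → ℝ} (hF : ∀ x y, |F x - F y| ≤ scaledNorm (x - y)) {M : ℝ≥0∞}
    (hM : M ≠ ∞ → 1 / 2 ≤ (gaussianVec n σ).real {x | ENNReal.ofReal (F x) ≤ M})
    {δ : ℝ} (hδ0 : 0 < δ) {q : ℝ} (hq : stdPhi q = 1 - δ) :
    (gaussianVec n σ {x | ENNReal.ofReal (F x) ≤ M + ENNReal.ofReal (σ * q / Real.sqrt n)}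
      ≥ 1 - ENNReal.ofReal δ) ∧
    (∫⁻ x, ENNReal.ofReal (F x) ∂(gaussianVec n σ)
      ≤ M + ENNReal.ofReal (σ / Real.sqrt (2 * Real.pi * n))) := by
  by_cases hMtop : M = ∞
  · subst hMtop
    simp
  specialize hM hMtop
  obtain ⟨m, hm0, rfl⟩ : ∃ m : ℝ, 0 ≤ m ∧ ENNReal.ofReal m = M :=
    ⟨M.toReal, ENNReal.toReal_nonneg, ENNReal.ofReal_toReal hMtop⟩
  simp only [ENNReal.ofReal_le_ofReal_iff hm0] at hM
  refine ⟨?_, lintegral_gaussianVec_le hn hσ hF hM⟩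
  have h1 := stdPhi_le_gaussianVec_real hn hσ hF hM (le_max_right q 0)
  have h2 : 1 - δ ≤ (gaussianVec n σ).real {x | F x ≤ m + σ * max q 0 / √n} :=
    hq ▸ (strictMono_stdPhi.monotone (le_max_left q 0)).trans h1
  rw [ge_iff_le, ← ENNReal.ofReal_one, ← ENNReal.ofReal_sub _ hδ0.le]
  refine (ENNReal.ofReal_le_ofReal h2).trans ?_
  rw [ofReal_measureReal]
  refine measure_mono fun x hx => ?_
  simp only [Set.mem_ofPred_eq] at hx ⊢
  refine (ENNReal.ofReal_le_ofReal hx).trans (ENNReal.ofReal_add_le.trans ?_)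
  refine add_le_add le_rfl ?_
  rcases le_total q 0 with h | h
  · simp [max_eq_right h]
  · rw [max_eq_left h]

/-- Oracle inequalities in probability (at any level `1-δ`, with `q = Φ⁻¹(1-δ)`)
and in expectation for the estimator penalized by the cone norm `λ‖·‖_𝒜` of a
polyhedral convex cone `𝒜` (polyhedrality encoded by finiteness of the extremal
point set `E` of `𝒜′ = closure(𝒜 ∩ {|a|₁ ≤ 1})`).  The oracle bound over
admissible sets `S` (with the convention `a/0 = +∞`) is expressed in `ℝ≥0∞`. -/
theorem stmt16 (n p : ℕ) (hn : 0 < n)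
    (A : Set (Fin p → ℝ)) (hAne : A.Nonempty)
    (hApos : ∀ a ∈ A, ∀ j, 0 < a j)
    (hAconv : Convex ℝ A)
    (hAcone : ∀ (c : ℝ), 0 < c → ∀ a ∈ A, c • a ∈ A)
    (E : Finset (Fin p → ℝ))
    (hE : (E : Set (Fin p → ℝ)) =
      Set.extremePoints ℝ (closure (A ∩ {a | (∑ j, |a j|) ≤ 1})))
    (σ : ℝ) (hσ : 0 < σ) (f : Fin n → ℝ)
    (X : Matrix (Fin n) (Fin p) ℝ)
    (hdiag : ∀ j : Fin p, (1 / n) * ∑ i, X i j ^ 2 ≤ 1)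
    (lam : ℝ)
    (hlam : 2 * σ / Real.sqrt n * (1 + Real.sqrt (2 * Real.log (2 * E.card))) ≤ lam)
    (βhat : (Fin n → ℝ) → (Fin p → ℝ))
    (hmin : ∀ (y : Fin n → ℝ) (b : Fin p → ℝ),
      scaledNorm (y - X.mulVec (βhat y)) ^ 2 + 2 * lam * coneNorm A (βhat y)
        ≤ scaledNorm (y - X.mulVec b) ^ 2 + 2 * lam * coneNorm A b)
    (δ : ℝ) (hδ0 : 0 < δ) (hδ1 : δ < 1)
    (q : ℝ) (hq : stdPhi q = 1 - δ) :
    (gaussianVec n σ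
        {ξ | ENNReal.ofReal (scaledNorm (X.mulVec (βhat (f + ξ)) - f))
          ≤ (⨅ (S : Finset (Fin p)) (_ : Admissible A S) (β : Fin p → ℝ)
                (_ : Function.support β = ↑S),
              (ENNReal.ofReal (scaledNorm (X.mulVec β - f)) +
                ENNReal.ofReal (3 * lam) /
                  ENNReal.ofReal (2 * Real.sqrt (qASq X A S 3))))
            + ENNReal.ofReal (σ * q / Real.sqrt n)}
      ≥ 1 - ENNReal.ofReal δ) ∧
    (∫⁻ ξ, ENNReal.ofReal (scaledNorm (X.mulVec (βhat (f + ξ)) - f)) ∂(gaussianVec n σ)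
      ≤ (⨅ (S : Finset (Fin p)) (_ : Admissible A S) (β : Fin p → ℝ)
            (_ : Function.support β = ↑S),
          (ENNReal.ofReal (scaledNorm (X.mulVec β - f)) +
            ENNReal.ofReal (3 * lam) /
              ENNReal.ofReal (2 * Real.sqrt (qASq X A S 3))))
        + ENNReal.ofReal (σ / Real.sqrt (2 * Real.pi * n))) := by
  have hn' : (0 : ℝ) < n := by exact_mod_cast hn
  have hl : 0 < lam := lt_of_lt_of_le (by positivity) hlam
  have hF : ∀ x y : Fin n → ℝ, |scaledNorm (X.mulVec (βhat (f + x)) - f)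
      - scaledNorm (X.mulVec (βhat (f + y)) - f)| ≤ scaledNorm (x - y) := fun x y => by
    refine (abs_scaledNorm_sub_le _ _).trans ?_
    have h := scaledNorm_mulVec_sub_le_of_isMin hAne hApos hAconv hAcone hl.le hmin (f + x) (f + y)
    rwa [add_sub_add_left_eq_sub, ← sub_sub_sub_cancel_right _ _ f] at h
  refine gaussianVec_deviation_and_expectation hn hσ hF (fun _ => ?_) hδ0 hq
  have hcont := continuous_of_abs_sub_le_scaledNorm hF
  refine one_half_le_gaussianVec_real_noise hn hAne hApos hAconv hAcone hE hσ hdiag hlam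
    (measurableSet_le (ENNReal.measurable_ofReal.comp hcont.measurable) measurable_const)
    fun ξ hξ => ?_
  rw [Set.mem_ofPred_eq]
  refine le_iInf fun S => le_iInf fun hS => le_iInf fun β => le_iInf fun hβ => ?_
  rcases le_or_gt (qASq X A S 3) 0 with hq0 | hq0
  · rw [Real.sqrt_eq_zero_of_nonpos hq0, mul_zero, ENNReal.ofReal_zero,
      ENNReal.div_zero (ENNReal.ofReal_pos.2 (by positivity)).ne', add_top]
    exact le_top
  · have h := scaledNorm_sub_le_oracle hAne hApos hAconv hAcone hl
      (hmin (f + ξ)) hξ hS hβ hq0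
    have hs : 0 < 2 * √(qASq X A S 3) := by positivity
    rw [← ENNReal.ofReal_div_of_pos hs, ← ENNReal.ofReal_add (scaledNorm_nonneg _) (by positivity)]
    exact ENNReal.ofReal_le_ofReal h
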